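/- arXiv:math/0104166 — 3 statements merged into one kernel-verified Lean document; each statement's English description precedes it below -/
import Mathlib

section
/- Every finitely generated (commutative, cancellative, torsion-free) monoid M with trivial group of units can be embedded into the free monoid Z_+^(rank M) in such a way that the embedding induces the equality gp(M) = Z^(rank M). -/
/-- Finitely many rational numbers have a common denominator. -/
theorem Rat.exists_common_denominator {ι : Type*} (s : Finset ι) (f : ι → ℚ) :
    ∃ d : ℕ, 0 < d ∧ ∀ i ∈ s, ∃ z : ℤ, (z : ℚ) = d * f i := by
  classical
  refine ⟨∏ i ∈ s, (f i).den, Finset.prod_pos fun i _ => (f i).den_pos, fun i hi => ?_⟩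
  refine ⟨(∏ j ∈ s.erase i, ((f j).den : ℤ)) * (f i).num, ?_⟩
  rw [← Finset.prod_erase_mul s _ hi]
  push_cast
  rw [mul_assoc, Rat.den_mul_eq_num]

/-- **Gordan's theorem** relative to a subspace: a finite family without nontrivial nonnegative
relations modulo `W` is strictly positive under some functional that vanishes on `W`. -/
theorem exists_dual_pos_of_no_nonneg_relation {K V ι : Type*} [Field K] [LinearOrder K]
    [IsStrictOrderedRing K] [AddCommGroup V] [Module K V] (v : ι → V) (s : Finset ι)
    (W : Submodule K V)
    (h : ∀ c : ι → K, (∀ i ∈ s, 0 ≤ c i) → ∑ i ∈ s, c i • v i ∈ W → ∀ i ∈ s, c i = 0) :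
    ∃ φ : V →ₗ[K] K, (∀ w ∈ W, φ w = 0) ∧ ∀ i ∈ s, 0 < φ (v i) := by
  classical
  induction s using Finset.induction_on generalizing W with
  | empty => exact ⟨0, by simp, by simp⟩
  | insert a s ha ih =>
    have sum_update : ∀ (c : ι → K) (t : K),
        ∑ i ∈ insert a s, Function.update c a t i • v i = t • v a + ∑ i ∈ s, c i • v i := by
      intro c t
      rw [Finset.sum_insert ha, Function.update_self]
      congr 1
      refine Finset.sum_congr rfl fun i hi => ?_
      rw [Function.update_of_ne (ne_of_mem_of_not_mem hi ha)]
    have extend : ∀ (c : ι → K) (t : K), (∀ i ∈ s, 0 ≤ c i) → 0 ≤ t →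
        t • v a + ∑ i ∈ s, c i • v i ∈ W → t = 0 ∧ ∀ i ∈ s, c i = 0 := by
      intro c t hc ht hW
      have key := h (Function.update c a t) ?_ (by rwa [sum_update])
      · refine ⟨by simpa using key a (Finset.mem_insert_self a s), fun i hi => ?_⟩
        simpa [Function.update_of_ne (ne_of_mem_of_not_mem hi ha)] using
          key i (Finset.mem_insert_of_mem hi)
      · intro i hi
        rcases Finset.mem_insert.1 hi with rfl | hi
        · simpa using ht
        · simpa [Function.update_of_ne (ne_of_mem_of_not_mem hi ha)] using hc i hi
    have hva : v a ∉ W := fun hmem =>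
      one_ne_zero (extend 0 1 (by simp) zero_le_one (by simpa using hmem)).1
    by_cases hq : ∀ c : ι → K, (∀ i ∈ s, 0 ≤ c i) →
        ∑ i ∈ s, c i • v i ∈ W ⊔ Submodule.span K {v a} → ∀ i ∈ s, c i = 0
    · obtain ⟨ψ, hψW, hψ⟩ := ih _ hq
      obtain ⟨χ, hχ, hχW⟩ := Submodule.exists_le_ker_of_notMem hva
      obtain ⟨χ, hχ, hχW⟩ : ∃ χ : V →ₗ[K] K, 0 < χ (v a) ∧ ∀ w ∈ W, χ w = 0 := by
        refine ⟨(χ (v a))⁻¹ • χ, by simp [hχ], fun w hw => ?_⟩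
        simp [LinearMap.mem_ker.1 (hχW hw)]
      have hψa : ψ (v a) = 0 :=
        hψW _ (Submodule.mem_sup_right (Submodule.mem_span_singleton_self _))
      obtain ⟨N, hN⟩ := (s.image fun i => (1 - χ (v i)) / ψ (v i)).exists_le
      refine ⟨N • ψ + χ, fun w hw => ?_, fun i hi => ?_⟩
      · simp [hψW w (Submodule.mem_sup_left hw), hχW w hw]
      · rcases Finset.mem_insert.1 hi with rfl | hi
        · simpa [hψa] using hχ
        · have := hN _ (Finset.mem_image_of_mem _ hi)
          rw [div_le_iff₀ (hψ i hi)] at this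
          simp only [LinearMap.add_apply, LinearMap.smul_apply, smul_eq_mul]
          linarith
    · push Not at hq
      obtain ⟨c, hc, hmem, j, hj, hcj⟩ := hq
      obtain ⟨φ, hφW, hφ⟩ := ih W fun c hc hW => (extend c 0 hc le_rfl (by simpa using hW)).2
      refine ⟨φ, hφW, fun i hi => ?_⟩
      rcases Finset.mem_insert.1 hi with rfl | hi
      · obtain ⟨w, hw, y, hy, hsum⟩ := Submodule.mem_sup.1 hmem
        obtain ⟨t, rfl⟩ := Submodule.mem_span_singleton.1 hy
        have ht : 0 < t := by
          by_contra! ht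
          refine hcj ((extend c (-t) hc (by linarith) ?_).2 j hj)
          rw [← hsum]
          simpa using hw
        have hpos : 0 < ∑ k ∈ s, c k * φ (v k) :=
          Finset.sum_pos' (fun k hk => mul_nonneg (hc k hk) (hφ k hk).le)
            ⟨j, hj, mul_pos ((hc j hj).lt_of_ne' hcj) (hφ j hj)⟩
        have := congrArg φ hsum
        simp only [map_add, hφW w hw, map_smul, map_sum, smul_eq_mul, zero_add] at this
        rw [← this] at hpos
        exact pos_of_mul_pos_right hpos ht.le
      · exact hφ i hi

/-- A nonzero integral functional on a group is a positive multiple of a surjective one. -/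
theorem LinearMap.exists_surjective_of_ne_zero {G : Type*} [AddCommGroup G]
    (φ : G →ₗ[ℤ] ℤ) (hφ : φ ≠ 0) :
    ∃ (ψ : G →ₗ[ℤ] ℤ) (x : G), ψ x = 1 ∧ ∀ y, 0 < φ y → 0 < ψ y := by
  obtain ⟨d, hd⟩ := (IsPrincipalIdealRing.principal (LinearMap.range φ)).principal
  have hdvd : ∀ y, d ∣ φ y := fun y => by
    have : φ y ∈ LinearMap.range φ := ⟨y, rfl⟩
    rw [hd] at this
    exact Ideal.mem_span_singleton.1 this
  obtain ⟨x, hx⟩ : d ∈ LinearMap.range φ := by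
    rw [hd]; exact Submodule.mem_span_singleton_self d
  have hd0 : d ≠ 0 := by
    rintro rfl
    exact hφ (LinearMap.ext fun y => zero_dvd_iff.1 (hdvd y))
  have hdiv : ∀ y, |d| ∣ φ y := fun y => (abs_dvd _ _).2 (hdvd y)
  let ψ : G →ₗ[ℤ] ℤ := AddMonoidHom.toIntLinearMap
    { toFun := fun y => φ y / |d|
      map_zero' := by simp
      map_add' := fun y z => by rw [map_add, Int.add_ediv_of_dvd_left (hdiv y)] }
  have hψ : ∀ y, ψ y * |d| = φ y := fun y => Int.ediv_mul_cancel (hdiv y)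
  have hd1 : 0 < |d| := abs_pos.2 hd0
  refine ⟨ψ, d.sign • x, ?_, fun y hy => ?_⟩
  · refine mul_right_cancel₀ hd1.ne' ?_
    rw [hψ, map_smul, hx, smul_eq_mul, Int.sign_mul_self_eq_abs, one_mul]
  · rw [← hψ] at hy
    exact pos_of_mul_pos_left hy hd1.le

/-- If a surjective functional is positive on a finite subset of a lattice, then the lattice has
coordinates in which that subset is nonnegative. -/
theorem exists_linearEquiv_nonneg {G : Type*} [AddCommGroup G] [Module.Free ℤ G]
    [Module.Finite ℤ G] (S : Finset G) (φ : G →ₗ[ℤ] ℤ) (x : G) (hx : φ x = 1)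
    (hS : ∀ s ∈ S, 0 < φ s) :
    ∃ (n : ℕ) (e : G ≃ₗ[ℤ] (Fin n → ℤ)), ∀ s ∈ S, ∀ i, 0 ≤ e s i := by
  classical
  let b := Module.finBasis ℤ (LinearMap.ker φ)
  let π : G →ₗ[ℤ] LinearMap.ker φ :=
    (LinearMap.id - φ.smulRight x).codRestrict _ (by simp [hx])
  have hπ : ∀ y, ((π y : LinearMap.ker φ) : G) = y - φ y • x := fun y => rfl
  let κ := b.equivFun.toLinearMap ∘ₗ π
  obtain ⟨N, hN⟩ := ((S ×ˢ Finset.univ).image fun p => -κ p.1 p.2).exists_le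
  have hN' : ∀ s ∈ S, ∀ i, -κ s i ≤ max N 0 := fun s hs i =>
    (hN _ (Finset.mem_image.2 ⟨(s, i), by simp [hs], rfl⟩)).trans (le_max_left _ _)
  let F : G →ₗ[ℤ] (Fin (Module.finrank ℤ (LinearMap.ker φ) + 1) → ℤ) :=
    LinearMap.pi (Fin.cons φ fun i => LinearMap.proj i ∘ₗ κ + max N 0 • φ)
  have hF0 : ∀ y, F y 0 = φ y := fun y => rfl
  have hFs : ∀ y i, F y (Fin.succ i) = b.equivFun (π y) i + max N 0 * φ y := fun y i => rfl
  have hinj : Function.Injective F := by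
    refine (injective_iff_map_eq_zero F).2 fun y hy => ?_
    have h0 : φ y = 0 := by rw [← hF0, hy]; rfl
    have h1 : π y = 0 := by
      apply b.equivFun.injective
      ext i
      have := hFs y i
      rw [hy, h0, mul_zero, add_zero] at this
      rw [← this, map_zero]; rfl
    have h2 := hπ y
    rw [h1, h0, zero_smul, sub_zero] at h2
    exact h2.symm
  have hsurj : Function.Surjective F := by
    intro z
    let k := b.equivFun.symm fun i => z i.succ - max N 0 * z 0
    have hφ : φ (z 0 • x + k) = z 0 := by
      rw [map_add, map_smul, hx, LinearMap.mem_ker.1 k.2]; simp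
    have hk : π (z 0 • x + k) = k := by
      apply Subtype.ext
      rw [hπ, hφ]; abel
    refine ⟨z 0 • x + k, funext fun i => ?_⟩
    refine Fin.cases ?_ (fun i => ?_) i
    · rw [hF0, hφ]
    · rw [hFs, hφ, hk, LinearEquiv.apply_symm_apply]; ring
  refine ⟨_, LinearEquiv.ofBijective F ⟨hinj, hsurj⟩, fun s hs i => ?_⟩
  change 0 ≤ F s i
  refine Fin.cases ?_ (fun i => ?_) i
  · exact (hS s hs).le
  · rw [hFs]
    have h1 : -b.equivFun (π s) i ≤ max N 0 := hN' s hs i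
    nlinarith [hS s hs, le_max_right N 0]

/-- A rational functional on a finitely generated free abelian group has a positive integral
multiple. -/
theorem exists_int_functional_pos {G : Type*} [AddCommGroup G] [Module.Free ℤ G]
    [Module.Finite ℤ G] (φ : G →ₗ[ℤ] ℚ) :
    ∃ ψ : G →ₗ[ℤ] ℤ, ∀ y, 0 < φ y → 0 < ψ y := by
  let b := Module.finBasis ℤ G
  obtain ⟨d, hd, hz⟩ := Rat.exists_common_denominator Finset.univ fun i => φ (b i)
  choose z hz using fun i => hz i (Finset.mem_univ i)
  have key : (Algebra.linearMap ℤ ℚ) ∘ₗ b.constr ℤ z = (d : ℤ) • φ :=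
    b.ext fun i => by simp [hz]
  refine ⟨b.constr ℤ z, fun y hy => ?_⟩
  have hy' : ((b.constr ℤ z y : ℤ) : ℚ) = d * φ y := by
    simpa using LinearMap.congr_fun key y
  have : (0 : ℚ) < (b.constr ℤ z y : ℤ) := by rw [hy']; positivity
  exact_mod_cast this

/-- In a submonoid of a rational vector space whose only unit is zero, nonzero elements satisfy no
nontrivial nonnegative relation. -/
theorem AddSubmonoid.eq_zero_of_nonneg_relation {V : Type*} [AddCommGroup V] [Module ℚ V]
    (M : AddSubmonoid V) (hunits : ∀ x ∈ M, -x ∈ M → x = 0) (S : Finset V)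
    (hS : ∀ s ∈ S, s ∈ M ∧ s ≠ 0) (c : V → ℚ) (hc : ∀ s ∈ S, 0 ≤ c s)
    (hsum : ∑ s ∈ S, c s • s = 0) : ∀ s ∈ S, c s = 0 := by
  classical
  obtain ⟨d, hd, hz⟩ := Rat.exists_common_denominator S c
  have hn : ∀ s ∈ S, ∃ n : ℕ, (n : ℚ) = d * c s := fun s hs => by
    obtain ⟨z, hz⟩ := hz s hs
    have : (0 : ℚ) ≤ z := by rw [hz]; exact mul_nonneg (by positivity) (hc s hs)
    lift z to ℕ using by exact_mod_cast this
    exact ⟨z, by simpa using hz⟩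
  choose! n hn using hn
  have hnsum : ∑ s ∈ S, n s • s = 0 := by
    rw [← smul_zero (d : ℚ), ← hsum, Finset.smul_sum]
    refine Finset.sum_congr rfl fun s hs => ?_
    rw [smul_smul, ← hn s hs, Nat.cast_smul_eq_nsmul]
  intro s hs
  by_contra hcs
  have hns : n s ≠ 0 := fun h0 => by
    have := hn s hs
    rw [h0] at this
    have hd' : (d : ℚ) ≠ 0 := by positivity
    simp_all
  obtain ⟨m, hm⟩ := Nat.exists_eq_succ_of_ne_zero hns
  refine (hS s hs).2 (hunits s (hS s hs).1 ?_)
  rw [← Finset.add_sum_erase S _ hs, hm, succ_nsmul'] at hnsum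
  rw [neg_eq_of_add_eq_zero_right (by rwa [add_assoc] at hnsum)]
  exact add_mem (nsmul_mem (hS s hs).1 m)
    (_root_.sum_mem fun t ht => nsmul_mem (hS t (Finset.mem_of_mem_erase ht)).1 _)

/-- The rank of a lattice in a rational vector space is the dimension of its rational span. -/
theorem AddSubgroup.finrank_span_eq_of_linearEquiv {V : Type*} [AddCommGroup V] [Module ℚ V]
    (A : Set V) {n : ℕ} (e : AddSubgroup.closure A ≃ₗ[ℤ] (Fin n → ℤ)) :
    Module.finrank ℚ (Submodule.span ℚ A) = n := by
  let b := Module.Basis.ofEquivFun e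
  let w : Fin n → V := fun i => b i
  have hw : LinearIndependent ℚ w := by
    rw [← LinearIndependent.iff_fractionRing ℤ ℚ]
    exact b.linearIndependent.map' (AddSubgroup.closure A).subtype.toIntLinearMap
      (LinearMap.ker_eq_bot.2 Subtype.val_injective)
  have hspan : Submodule.span ℚ A = Submodule.span ℚ (Set.range w) := by
    refine le_antisymm (Submodule.span_le.2 fun x hx => ?_) (Submodule.span_le.2 ?_)
    · have hrepr := congrArg (AddSubgroup.closure A).subtype
        (b.sum_repr ⟨x, AddSubgroup.subset_closure hx⟩)
      rw [map_sum] at hrepr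
      change _ = x at hrepr
      rw [← hrepr]
      refine _root_.sum_mem fun i _ => ?_
      rw [map_zsmul]
      exact _root_.zsmul_mem (Submodule.subset_span (Set.mem_range_self i)) _
    · rintro _ ⟨i, rfl⟩
      exact (AddSubgroup.closure_le (K := (Submodule.span ℚ A).toAddSubgroup)).2
        Submodule.subset_span (b i).2
  rw [hspan, finrank_span_eq_card hw, Fintype.card_fin]

/-- The group of differences of a finitely generated submonoid with trivial units has coordinates
in which the monoid is nonnegative. -/
theorem AddSubmonoid.exists_linearEquiv_closure_nonneg {V : Type*} [AddCommGroup V] [Module ℚ V]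
    (M : AddSubmonoid V) (hFG : M.FG) (hunits : ∀ x ∈ M, -x ∈ M → x = 0) :
    ∃ (n : ℕ) (e : AddSubgroup.closure (M : Set V) ≃ₗ[ℤ] (Fin n → ℤ)),
      ∀ x : AddSubgroup.closure (M : Set V), (x : V) ∈ M → ∀ i, 0 ≤ e x i := by
  classical
  obtain ⟨T, hT⟩ := hFG
  have hTM : ∀ t ∈ T, t ∈ M := fun t ht => hT ▸ AddSubmonoid.subset_closure ht
  have hTG : AddSubgroup.closure (T : Set V) = AddSubgroup.closure (M : Set V) := by
    refine le_antisymm (AddSubgroup.closure_mono hTM) ((AddSubgroup.closure_le _).2 ?_)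
    rw [← hT]
    exact AddSubmonoid.closure_le (S := (AddSubgroup.closure (T : Set V)).toAddSubmonoid).2
      AddSubgroup.subset_closure
  have : Module.Finite ℤ (AddSubgroup.closure (M : Set V)) := by
    rw [← hTG]
    exact Module.Finite.iff_addGroup_fg.2 ((AddGroup.fg_iff_addSubgroup_fg _).2 ⟨T, rfl⟩)
  have : Module.IsTorsionFree ℤ V := Module.IsTorsionFree.trans ℚ
  have : Module.IsTorsionFree ℤ (AddSubgroup.closure (M : Set V)) :=
    Subtype.val_injective.moduleIsTorsionFree _ fun _ _ => rfl
  set G := AddSubgroup.closure (M : Set V)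
  let S : Finset V := T.erase 0
  have hSM : ∀ s ∈ S, s ∈ M ∧ s ≠ 0 := fun s hs =>
    ⟨hTM s (Finset.mem_of_mem_erase hs), Finset.ne_of_mem_erase hs⟩
  obtain ⟨φ, -, hφ⟩ := exists_dual_pos_of_no_nonneg_relation (K := ℚ) id S ⊥
    fun c hc h => M.eq_zero_of_nonneg_relation hunits S hSM c hc (by simpa using h)
  obtain ⟨ψ, hψ⟩ := exists_int_functional_pos
    (φ.restrictScalars ℤ ∘ₗ G.subtype.toIntLinearMap)
  suffices ∃ (n : ℕ) (e : G ≃ₗ[ℤ] (Fin n → ℤ)), ∀ s : G, (s : V) ∈ S → ∀ i, 0 ≤ e s i by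
    obtain ⟨n, e, he⟩ := this
    refine ⟨n, e, fun x hx i => ?_⟩
    have hle : M ≤ ((AddSubmonoid.nonneg ℤ).comap
        ((Pi.evalAddMonoidHom _ i).comp e.toLinearMap.toAddMonoidHom)).map
          G.toAddSubmonoid.subtype := by
      rw [← hT, AddSubmonoid.closure_le]
      intro t ht
      refine ⟨⟨t, AddSubgroup.subset_closure (hTM t ht)⟩, ?_, rfl⟩
      change 0 ≤ e ⟨t, _⟩ i
      by_cases h0 : t = 0
      · subst h0
        exact (congrFun (map_zero e) i).ge
      · exact he ⟨t, _⟩ (Finset.mem_erase.2 ⟨h0, ht⟩) i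
    obtain ⟨y, hy, hyx⟩ := hle hx
    obtain rfl : y = x := Subtype.ext hyx
    exact hy
  by_cases h0 : ψ = 0
  · refine ⟨_, (Module.finBasis ℤ G).equivFun, fun s hs => ?_⟩
    have := hψ s (hφ s hs)
    simp [h0] at this
  · obtain ⟨χ, x, hx, hχ⟩ := ψ.exists_surjective_of_ne_zero h0
    obtain ⟨n, e, he⟩ := exists_linearEquiv_nonneg
      (S.preimage ((↑) : G → V) Subtype.val_injective.injOn) χ x hx
      fun s hs => hχ s (hψ s (hφ s (Finset.mem_preimage.1 hs)))
    exact ⟨n, e, fun s hs => he s (Finset.mem_preimage.2 hs)⟩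

/-- Every finitely generated (commutative, cancellative, torsion-free) monoid `M`
with trivial group of units embeds into `ℤ₊^(rank M)` (nonnegative coordinates),
inducing the equality `gp(M) = ℤ^(rank M)`. Here `rank M = dim_ℚ (ℚ ⊗ gp M)`, which
for a submonoid of a `ℚ`-vector space is the dimension of the `ℚ`-span of `M`. -/
theorem stmt6 {V : Type} [AddCommGroup V] [Module ℚ V] (M : AddSubmonoid V)
    (hFG : M.FG) (hunits : ∀ x ∈ M, -x ∈ M → x = 0) :
    ∃ f : AddSubgroup.closure (M : Set V) →+
        (Fin (Module.finrank ℚ (Submodule.span ℚ (M : Set V))) → ℤ),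
      Function.Injective f ∧
      (∀ x : AddSubgroup.closure (M : Set V), (x : V) ∈ M → ∀ i, 0 ≤ f x i) ∧
      AddSubgroup.closure (⇑f '' {x | (x : V) ∈ M}) = ⊤ := by
  obtain ⟨n, e, he⟩ := M.exists_linearEquiv_closure_nonneg hFG hunits
  obtain rfl := AddSubgroup.finrank_span_eq_of_linearEquiv _ e
  refine ⟨e.toLinearMap.toAddMonoidHom, e.injective, he, ?_⟩
  rw [← AddMonoidHom.map_closure]
  have htop : AddSubgroup.closure {x : AddSubgroup.closure (M : Set V) | (x : V) ∈ M} = ⊤ :=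
    AddSubgroup.closure_closure_coe_preimage
  rw [htop, AddSubgroup.map_top_of_surjective _ e.surjective]
end

section
/- For any commutative, cancellative, torsion-free monoid M and any sequence c = (c_1, c_2, ...) of natural numbers ≥ 2, the monoid M^c, defined as the filtered union of M/c_1 ⊆ M/(c_1c_2) ⊆ ⋯ inside Q ⊗ gp(M), is seminormal. -/
/-- Scaling by a rational number `q`, as an additive monoid homomorphism of a
`ℚ`-vector space. -/
def scaleHom {V : Type} [AddCommGroup V] [Module ℚ V] (q : ℚ) : V →+ V :=
  AddMonoidHom.mk' (fun v => q • v) fun a b => smul_add q a b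

/-- The monoid `M^𝔠`: the filtered union `M/c₁ ⊆ M/(c₁c₂) ⊆ ⋯` inside the ambient
`ℚ`-vector space (which contains `ℚ ⊗ gp M`). -/
def dilatedUnion {V : Type} [AddCommGroup V] [Module ℚ V] (M : AddSubmonoid V)
    (c : ℕ → ℕ) : AddSubmonoid V :=
  ⨆ j : ℕ, M.map (scaleHom ((∏ n ∈ Finset.range j, (c n : ℚ)))⁻¹)

/-- A submonoid `N` of a `ℚ`-vector space is seminormal if every `x` in its group of
differences with `2 • x ∈ N` and `3 • x ∈ N` lies in `N`. -/
def IsSeminormalMonoid {V : Type} [AddCommGroup V] [Module ℚ V] (N : AddSubmonoid V) : Prop :=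
  ∀ x ∈ AddSubgroup.closure (N : Set V), (2 : ℕ) • x ∈ N → (3 : ℕ) • x ∈ N → x ∈ N

theorem mem_map_scaleHom_inv_iff {V : Type} [AddCommGroup V] [Module ℚ V] (M : AddSubmonoid V)
    {k : ℕ} (hk : k ≠ 0) (x : V) :
    x ∈ M.map (scaleHom ((k : ℚ)⁻¹)) ↔ k • x ∈ M := by
  have hk' : (k : ℚ) ≠ 0 := Nat.cast_ne_zero.mpr hk
  constructor
  · rintro ⟨y, hy, rfl⟩
    have h : k • scaleHom ((k : ℚ)⁻¹) y = y := by
      rw [← Nat.cast_smul_eq_nsmul ℚ]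
      exact smul_inv_smul₀ hk' y
    rwa [h]
  · intro hx
    refine ⟨k • x, hx, ?_⟩
    rw [← Nat.cast_smul_eq_nsmul ℚ]
    exact inv_smul_smul₀ hk' x

theorem nsmul_prod_range_mem_of_le {V : Type} [AddCommGroup V] (M : AddSubmonoid V)
    (c : ℕ → ℕ) (x : V) {i j : ℕ} (hij : i ≤ j)
    (hx : (∏ n ∈ Finset.range i, c n) • x ∈ M) : (∏ n ∈ Finset.range j, c n) • x ∈ M := by
  induction j, hij using Nat.le_induction with
  | base => exact hx
  | succ j _ ih =>
    rw [Finset.prod_range_succ, mul_comm, mul_smul]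
    exact M.nsmul_mem ih _

theorem mem_dilatedUnion_iff {V : Type} [AddCommGroup V] [Module ℚ V] (M : AddSubmonoid V)
    (c : ℕ → ℕ) (hc : ∀ n, c n ≠ 0) (x : V) :
    x ∈ dilatedUnion M c ↔ ∃ j, (∏ n ∈ Finset.range j, c n) • x ∈ M := by
  have key (j : ℕ) (y : V) :
      y ∈ M.map (scaleHom ((∏ n ∈ Finset.range j, (c n : ℚ)))⁻¹) ↔
        (∏ n ∈ Finset.range j, c n) • y ∈ M := by
    rw [← Nat.cast_prod]
    exact mem_map_scaleHom_inv_iff M (Finset.prod_ne_zero_iff.mpr fun n _ => hc n) y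
  have mono : Monotone fun j : ℕ => M.map (scaleHom ((∏ n ∈ Finset.range j, (c n : ℚ)))⁻¹) :=
    fun i j hij y hy => (key j y).mpr (nsmul_prod_range_mem_of_le M c y hij ((key i y).mp hy))
  rw [dilatedUnion, AddSubmonoid.mem_iSup_of_directed mono.directed_le]
  exact exists_congr fun j => key j x

theorem AddSubmonoid.nsmul_mem_of_two_three {V : Type} [AddCommMonoid V] (M : AddSubmonoid V)
    {x : V} (h2 : 2 • x ∈ M) (h3 : 3 • x ∈ M) {k : ℕ} (hk : 2 ≤ k) : k • x ∈ M := by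
  obtain ⟨a, b, rfl⟩ : ∃ a b, k = a * 2 + b * 3 := by
    rcases Nat.even_or_odd' k with ⟨m, rfl | rfl⟩
    · exact ⟨m, 0, by omega⟩
    · exact ⟨m - 1, 1, by omega⟩
  rw [add_smul, mul_smul, mul_smul]
  exact M.add_mem (M.nsmul_mem h2 a) (M.nsmul_mem h3 b)

/-- For any commutative, cancellative, torsion-free monoid `M` and any sequence
`𝔠 = (c₁, c₂, …)` of natural numbers `≥ 2`, the monoid `M^𝔠` is seminormal. -/
theorem stmt9 {V : Type} [AddCommGroup V] [Module ℚ V] (M : AddSubmonoid V)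
    (c : ℕ → ℕ) (hc : ∀ n, 2 ≤ c n) :
    IsSeminormalMonoid (dilatedUnion M c) := by
  intro x _ h2 h3
  have hc0 (n : ℕ) : c n ≠ 0 := by have := hc n; omega
  rw [mem_dilatedUnion_iff M c hc0] at h2 h3 ⊢
  obtain ⟨i, hi⟩ := h2
  obtain ⟨j, hj⟩ := h3
  have hi' := nsmul_prod_range_mem_of_le M c _ (le_max_left i j) hi
  have hj' := nsmul_prod_range_mem_of_le M c _ (le_max_right i j) hj
  rw [smul_comm] at hi' hj'
  refine ⟨max i j + 1, ?_⟩
  rw [Finset.prod_range_succ, mul_comm, mul_smul]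
  exact M.nsmul_mem_of_two_three hi' hj' (hc _)
end

section
/- No polytope is simultaneously a bipyramid and a pyramid: if Q is a bipyramid over a polytope P, then Q is not a pyramid over any of its facets. Consequently, the 0-1 sequence σ(P) of a polytope P in the class 𝔓 is uniquely determined by the combinatorial type of P, and in dimension r > 0 there are exactly 2^{r−1} distinct 𝔓-combinatorial types. -/
/-- A (convex) polytope: the convex hull of a finite set. -/
def IsPolytope {d : ℕ} (P : Set (Fin d → ℝ)) : Prop :=
  ∃ s : Finset (Fin d → ℝ), P = convexHull ℝ (s : Set (Fin d → ℝ))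

/-- `Q` is a pyramid over `P`: the convex hull of `P` and an apex outside the affine
hull of `P`. -/
def IsPyramidOver {d : ℕ} (Q P : Set (Fin d → ℝ)) : Prop :=
  ∃ v, v ∉ affineSpan ℝ P ∧ Q = convexHull ℝ (insert v P)

/-- `Q` is a bipyramid over `P`: `Q = conv(σ ∪ P)` for a segment `σ` whose relative
interior meets the relative interior of `P` in exactly one point. -/
def IsBipyramidOver {d : ℕ} (Q P : Set (Fin d → ℝ)) : Prop :=
  ∃ x y z : Fin d → ℝ, x ≠ y ∧
    intrinsicInterior ℝ (segment ℝ x y) ∩ intrinsicInterior ℝ P = {z} ∧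
    Q = convexHull ℝ (insert x (insert y P))

/-- The class `𝔓`, together with the 0-1 sequence `σ(P)` recording the construction:
`P₁` is a segment and each later step is a pyramid (`false`) or a bipyramid (`true`);
the head of the list corresponds to the last (top-dimensional) step. A polytope `P`
with `InP L P` has dimension `L.length + 1`. -/
inductive InP {d : ℕ} : List Bool → Set (Fin d → ℝ) → Prop
  | seg (x y : Fin d → ℝ) : x ≠ y → InP [] (segment ℝ x y)
  | pyr (L : List Bool) (P Q : Set (Fin d → ℝ)) :
      InP L P → IsPyramidOver Q P → InP (false :: L) Q
  | bipyr (L : List Bool) (P Q : Set (Fin d → ℝ)) :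
      InP L P → IsBipyramidOver Q P → InP (true :: L) Q

/-- The faces of a polytope `P`: its convex extreme subsets. -/
def Faces {d : ℕ} (P : Set (Fin d → ℝ)) : Type :=
  {F : Set (Fin d → ℝ) // IsExtreme ℝ P F ∧ Convex ℝ F}

/-- `P` and `Q` have the same combinatorial type: their face lattices are isomorphic
as partially ordered sets. -/
def CombEquiv {d e : ℕ} (P : Set (Fin d → ℝ)) (Q : Set (Fin e → ℝ)) : Prop :=
  ∃ φ : Faces P ≃ Faces Q, ∀ F G : Faces P, F.1 ⊆ G.1 ↔ (φ F).1 ⊆ (φ G).1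

section

open Polynomial

/-- `c` is the corank function of the poset `α`: the length of a longest chain going up
from an element. -/
structure IsCorank {α : Type*} [PartialOrder α] (c : α → ℕ) : Prop where
  strictAnti : StrictAnti c
  exists_gt : ∀ a, c a ≠ 0 → ∃ b, a < b ∧ c b + 1 = c a

theorem IsCorank.le {α : Type*} [PartialOrder α] {c c' : α → ℕ}
    (h : IsCorank c) (h' : IsCorank c') (a : α) : c a ≤ c' a := by
  induction hn : c a generalizing a with
  | zero => exact Nat.zero_le _
  | succ n ih =>
    obtain ⟨b, hab, hb⟩ := h.exists_gt a (by omega)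
    have := ih b (by omega)
    have := h'.strictAnti hab
    omega

theorem IsCorank.eq {α : Type*} [PartialOrder α] {c c' : α → ℕ}
    (h : IsCorank c) (h' : IsCorank c') : c = c' :=
  funext fun a => (h.le h' a).antisymm (h'.le h a)

theorem IsCorank.comp_orderIso {α β : Type*} [PartialOrder α] [PartialOrder β] {c : β → ℕ}
    (h : IsCorank c) (e : α ≃o β) : IsCorank (c ∘ e) where
  strictAnti _ _ hab := h.strictAnti (e.lt_iff_lt.2 hab)
  exists_gt a ha := by
    obtain ⟨b, hab, hb⟩ := h.exists_gt (e a) ha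
    exact ⟨e.symm b, e.lt_symm_apply.2 hab, by simpa using hb⟩

theorem IsCorank.prod {α β : Type*} [PartialOrder α] [PartialOrder β] {c : α → ℕ} {c' : β → ℕ}
    (h : IsCorank c) (h' : IsCorank c') : IsCorank fun p : α × β => c p.1 + c' p.2 where
  strictAnti p q hpq := by
    rcases Prod.lt_iff.1 hpq with ⟨h₁, h₂⟩ | ⟨h₁, h₂⟩
    · exact add_lt_add_of_lt_of_le (h.strictAnti h₁) (h'.strictAnti.antitone h₂)
    · exact add_lt_add_of_le_of_lt (h.strictAnti.antitone h₁) (h'.strictAnti h₂)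
  exists_gt := by
    rintro ⟨a, b⟩ hab
    by_cases ha : c a = 0
    · obtain ⟨b', hb, hb'⟩ := h'.exists_gt b (by simp only at hab; omega)
      exact ⟨(a, b'), Prod.mk_lt_mk_iff_right.2 hb, by simp only; omega⟩
    · obtain ⟨a', ha, ha'⟩ := h.exists_gt a ha
      exact ⟨(a', b), Prod.mk_lt_mk_iff_left.2 ha, by simp only; omega⟩

theorem IsCorank.withTop {α : Type*} [PartialOrder α] {c : α → ℕ} (h : IsCorank c) :
    IsCorank (WithTop.recTopCoe 0 fun a => c a + 1 : WithTop α → ℕ) where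
  strictAnti a b hab := by
    induction a using WithTop.recTopCoe with
    | top => exact absurd hab not_top_lt
    | coe a =>
      induction b using WithTop.recTopCoe with
      | top => exact Nat.succ_pos _
      | coe b => exact Nat.succ_lt_succ (h.strictAnti (WithTop.coe_lt_coe.1 hab))
  exists_gt a ha := by
    induction a using WithTop.recTopCoe with
    | top => exact absurd rfl ha
    | coe a =>
      by_cases hc : c a = 0
      · exact ⟨⊤, WithTop.coe_lt_top a, by simp [hc]⟩
      · obtain ⟨b, hb, hb'⟩ := h.exists_gt a hc
        exact ⟨b, WithTop.coe_lt_coe.2 hb, by simp [hb']⟩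

theorem IsCorank.subtype_ne_top {α : Type*} [PartialOrder α] [OrderTop α] {c : α → ℕ}
    (h : IsCorank c) : IsCorank fun a : {a : α // a ≠ ⊤} => c a - 1 := by
  have pos : ∀ a : α, a ≠ ⊤ → 0 < c a := fun a ha =>
    (Nat.zero_le _).trans_lt (h.strictAnti (lt_top_iff_ne_top.2 ha))
  refine ⟨fun a b hab => ?_, fun a ha => ?_⟩
  · have := h.strictAnti (show (a : α) < b from hab)
    have := pos b b.2
    omega
  · obtain ⟨b, hb, hb'⟩ := h.exists_gt a (pos a a.2).ne'
    have hbt : b ≠ ⊤ := by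
      rintro rfl
      by_cases ht : c (⊤ : α) = 0
      · omega
      · obtain ⟨x, hx, -⟩ := h.exists_gt ⊤ ht
        exact not_top_lt hx
    have := pos b hbt
    exact ⟨⟨b, hbt⟩, hb, by simp only; omega⟩

/-- `p` is the face polynomial of the finite poset `α`: the generating polynomial of the
coranks of its elements, in the variable `X - 1`. -/
def HasFacePoly (α : Type*) [PartialOrder α] (p : ℤ[X]) : Prop :=
  ∃ (_ : Fintype α) (c : α → ℕ), IsCorank c ∧ ∑ a, (X - 1) ^ c a = p

theorem HasFacePoly.unique {α β : Type*} [PartialOrder α] [PartialOrder β] {p q : ℤ[X]}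
    (hp : HasFacePoly α p) (hq : HasFacePoly β q) (e : α ≃o β) : p = q := by
  obtain ⟨_, c, hc, rfl⟩ := hp
  obtain ⟨_, c', hc', rfl⟩ := hq
  rw [hc.eq (hc'.comp_orderIso e)]
  exact e.toEquiv.sum_comp fun b => (X - 1 : ℤ[X]) ^ c' b

theorem HasFacePoly.of_orderIso {α β : Type*} [PartialOrder α] [PartialOrder β] {p : ℤ[X]}
    (hp : HasFacePoly β p) (e : α ≃o β) : HasFacePoly α p := by
  obtain ⟨_, c, hc, rfl⟩ := hp
  let _ : Fintype α := Fintype.ofEquiv β e.symm.toEquiv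
  exact ⟨_, c ∘ e, hc.comp_orderIso e, e.toEquiv.sum_comp fun b => (X - 1 : ℤ[X]) ^ c b⟩

theorem HasFacePoly.prod {α β : Type*} [PartialOrder α] [PartialOrder β] {p q : ℤ[X]}
    (hp : HasFacePoly α p) (hq : HasFacePoly β q) : HasFacePoly (α × β) (p * q) := by
  obtain ⟨_, c, hc, rfl⟩ := hp
  obtain ⟨_, c', hc', rfl⟩ := hq
  refine ⟨inferInstance, _, hc.prod hc', ?_⟩
  simp only [pow_add, Fintype.sum_prod_type, Finset.sum_mul_sum]

theorem HasFacePoly.withTop {α : Type*} [PartialOrder α] {p : ℤ[X]} (hp : HasFacePoly α p) :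
    HasFacePoly (WithTop α) (1 + (X - 1) * p) := by
  obtain ⟨_, c, hc, rfl⟩ := hp
  refine ⟨inferInstanceAs (Fintype (Option α)), _, hc.withTop, ?_⟩
  rw [Finset.mul_sum]
  refine (Fintype.sum_option (α := α) _).trans ?_
  refine congrArg₂ (· + ·) (pow_zero _) (Finset.sum_congr rfl fun a _ => pow_succ' _ _)

theorem HasFacePoly.subtype_ne_top {α : Type*} [PartialOrder α] [OrderTop α] {p : ℤ[X]}
    (hp : HasFacePoly α p) :
    ∃ q, HasFacePoly {a : α // a ≠ ⊤} q ∧ p = 1 + (X - 1) * q := by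
  classical
  have hp' := hp
  obtain ⟨_, c, hc, -⟩ := hp
  have hq : HasFacePoly {a : α // a ≠ ⊤} _ := ⟨inferInstance, _, hc.subtype_ne_top, rfl⟩
  exact ⟨_, hq, hp'.unique hq.withTop WithTop.subtypeOrderIso.symm⟩

theorem hasFacePoly_prop : HasFacePoly Prop X := by
  classical
  refine ⟨inferInstance, fun a => if a then 0 else 1, ⟨fun a b hab => ?_, fun a ha => ?_⟩, ?_⟩
  · by_cases ha : a
    · have hb : b := hab.le ha
      exact absurd hab (by simp [ha, hb])
    · by_cases hb : b
      · simp [ha, hb]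
      · exact absurd hab (by simp [ha, hb])
  · have ha : ¬ a := by simpa using ha
    exact ⟨True, by simp [ha, lt_iff_le_not_ge], by simp [ha]⟩
  · simp [Fintype.univ_Prop]

theorem hasFacePoly_proper_pair : HasFacePoly {b : Prop × Prop // b ≠ ⊤} (X + 1) := by
  obtain ⟨q, hq, h⟩ := (hasFacePoly_prop.prod hasFacePoly_prop).subtype_ne_top
  have hX : (X - 1 : ℤ[X]) ≠ 0 := X_sub_C_ne_zero 1
  rwa [mul_left_cancel₀ hX (show (X - 1) * (X + 1) = (X - 1) * q by linear_combination h)]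

theorem HasFacePoly.of_proper_orderIso {α β : Type*} [PartialOrder α] [OrderTop α]
    [PartialOrder β] [OrderTop β] {p : ℤ[X]} (hp : HasFacePoly α p)
    (e : {b : β // b ≠ ⊤} ≃o {a : α // a ≠ ⊤} × {b : Prop × Prop // b ≠ ⊤}) :
    HasFacePoly β (1 + (p - 1) * (X + 1)) := by
  classical
  obtain ⟨q, hq, rfl⟩ := hp.subtype_ne_top
  have h := (((hq.prod hasFacePoly_proper_pair).of_orderIso e).withTop).of_orderIso
    (WithTop.subtypeOrderIso (α := β)).symm
  convert h using 1
  ring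

/-- The face polynomial of a polytope of the class `𝔓` with a given construction sequence. -/
noncomputable def facePoly : List Bool → ℤ[X]
  | [] => X * X
  | false :: L => facePoly L * X
  | true :: L => 1 + (facePoly L - 1) * (X + 1)

theorem four_le_eval_facePoly (L : List Bool) : 4 ≤ (facePoly L).eval 2 := by
  induction L with
  | nil => simp [facePoly]
  | cons b L ih => cases b <;> simp [facePoly] <;> linarith

theorem eval_zero_facePoly (L : List Bool) : (facePoly L).eval 0 = 0 := by
  induction L with
  | nil => simp [facePoly]
  | cons b L ih => cases b <;> simp [facePoly, ih]

theorem eval_zero_derivative_facePoly_le (L : List Bool) :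
    (derivative (facePoly L)).eval 0 ≤ 0 := by
  induction L with
  | nil => simp [facePoly]
  | cons b L ih =>
    cases b
    · simp [facePoly, eval_zero_facePoly]
    · simp [facePoly, eval_zero_facePoly]; linarith

theorem eval_zero_derivative_facePoly_true_lt (L : List Bool) :
    (derivative (facePoly (true :: L))).eval 0 < 0 := by
  have := eval_zero_derivative_facePoly_le L
  simp [facePoly, eval_zero_facePoly]; linarith

theorem eval_zero_derivative_facePoly_false (L : List Bool) :
    (derivative (facePoly (false :: L))).eval 0 = 0 := by
  simp [facePoly, eval_zero_facePoly]

theorem facePoly_nil_ne_cons (b : Bool) (L : List Bool) : facePoly [] ≠ facePoly (b :: L) := by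
  intro h
  cases b
  · have h' := four_le_eval_facePoly L
    rw [← mul_right_cancel₀ X_ne_zero (show X * X = facePoly L * X from h)] at h'
    simp at h'
  · have h' := eval_zero_derivative_facePoly_true_lt L
    rw [← h] at h'
    simp [facePoly] at h'

theorem facePoly_injective : Function.Injective facePoly := by
  intro L₁
  induction L₁ with
  | nil =>
    rintro (_ | ⟨b, L⟩) h
    · rfl
    · exact absurd h (facePoly_nil_ne_cons b L)
  | cons b L₁ ih =>
    rintro (_ | ⟨b', L₂⟩) h
    · exact absurd h.symm (facePoly_nil_ne_cons b L₁)
    · have h₀ := congrArg (fun p => (derivative p).eval 0) h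
      cases b <;> cases b'
      · rw [ih (mul_right_cancel₀ X_ne_zero (show facePoly L₁ * X = facePoly L₂ * X from h))]
      · have := eval_zero_derivative_facePoly_true_lt L₂
        simp only [eval_zero_derivative_facePoly_false] at h₀
        omega
      · have := eval_zero_derivative_facePoly_true_lt L₁
        simp only [eval_zero_derivative_facePoly_false] at h₀
        omega
      · have hX : (X + 1 : ℤ[X]) ≠ 0 := X_add_C_ne_zero 1
        have h : 1 + (facePoly L₁ - 1) * (X + 1) = 1 + (facePoly L₂ - 1) * (X + 1) := h
        rw [ih (sub_left_injective (mul_right_cancel₀ hX (add_left_cancel h)))]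

end

theorem exists_linearMap_of_notMem_affineSpan {d : ℕ} {P : Set (Fin d → ℝ)} {v : Fin d → ℝ}
    (hv : v ∉ affineSpan ℝ P) :
    ∃ (f : (Fin d → ℝ) →ₗ[ℝ] ℝ) (c : ℝ), (∀ p ∈ P, f p = c) ∧ f v = c + 1 := by
  rcases P.eq_empty_or_nonempty with rfl | ⟨p₀, hp₀⟩
  · exact ⟨0, -1, by simp, by simp⟩
  have hp₀' := subset_affineSpan ℝ P hp₀
  have hv' : v - p₀ ∉ (affineSpan ℝ P).direction := fun h =>
    hv ((AffineSubspace.vsub_right_mem_direction_iff_mem hp₀' v).1 h)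
  obtain ⟨f, hf, hf'⟩ := Submodule.exists_dual_map_eq_bot_of_notMem hv' inferInstance
  refine ⟨(f (v - p₀))⁻¹ • f, (f (v - p₀))⁻¹ * f p₀, fun p hp => ?_, ?_⟩
  · have h : f (p - p₀) = 0 := by
      rw [← Submodule.mem_bot ℝ, ← hf']
      exact Submodule.mem_map_of_mem
        (AffineSubspace.vsub_mem_direction (subset_affineSpan ℝ P hp) hp₀')
    rw [map_sub, sub_eq_zero] at h
    simp [h]
  · have : (f (v - p₀))⁻¹ * f (v - p₀) = 1 := inv_mul_cancel₀ hf
    rw [map_sub] at this hf ⊢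
    simp only [LinearMap.smul_apply, smul_eq_mul]
    linarith

theorem mem_convexHull_insert_iff {E : Type*} [AddCommGroup E] [Module ℝ E] {G : Set E}
    (hG : Convex ℝ G) {v q : E} :
    q ∈ convexHull ℝ (insert v G) ↔
      q = v ∨ ∃ g ∈ G, ∃ t : ℝ, 0 ≤ t ∧ t < 1 ∧ q = t • v + (1 - t) • g := by
  rcases G.eq_empty_or_nonempty with rfl | hne
  · simp
  rw [convexHull_insert hne, hG.convexHull_eq, mem_convexJoin]
  simp only [Set.mem_singleton_iff, exists_eq_left]
  constructor
  · rintro ⟨g, hg, a, b, ha, hb, hab, rfl⟩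
    obtain rfl : b = 1 - a := by linarith
    rcases hb.eq_or_lt with hb | hb
    · left
      obtain rfl : a = 1 := by linarith
      simp
    · exact Or.inr ⟨g, hg, a, ha, by linarith, rfl⟩
  · rintro (rfl | ⟨g, hg, t, ht, ht', rfl⟩)
    · obtain ⟨g, hg⟩ := hne
      exact ⟨g, hg, left_mem_segment ℝ q g⟩
    · exact ⟨g, hg, t, 1 - t, ht, by linarith, by ring, rfl⟩

theorem subset_convexHull_insert {E : Type*} [AddCommGroup E] [Module ℝ E] (v : E) (G : Set E) :
    G ⊆ convexHull ℝ (insert v G) :=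
  (Set.subset_insert v G).trans (subset_convexHull ℝ _)

theorem mem_convexHull_insert_self {E : Type*} [AddCommGroup E] [Module ℝ E] (v : E)
    (G : Set E) : v ∈ convexHull ℝ (insert v G) :=
  subset_convexHull ℝ _ (Set.mem_insert v G)

/-- An extreme subset of a pyramid or bipyramid meets the open segments from the apex to the
base only in segments whose endpoints it contains. -/
theorem IsExtreme.mem_and_mem_of_mem_convexHull_insert {E : Type*} [AddCommGroup E] [Module ℝ E]
    {Q P F : Set E} (hF : IsExtreme ℝ Q F) (hP : Convex ℝ P) {v q : E} (hvQ : v ∈ Q)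
    (hPQ : P ⊆ Q) (hq : q ∈ F) (hq' : q ∈ convexHull ℝ (insert v P)) :
    q ∈ P ∨ (v ∈ F ∧ q ∈ convexHull ℝ (insert v (F ∩ P))) := by
  rcases (mem_convexHull_insert_iff hP).1 hq' with rfl | ⟨p, hp, t, ht, ht', rfl⟩
  · exact Or.inr ⟨hq, mem_convexHull_insert_self _ _⟩
  rcases ht.eq_or_lt with rfl | ht
  · left; simpa using hp
  have hseg : t • v + (1 - t) • p ∈ openSegment ℝ v p :=
    ⟨t, 1 - t, ht, by linarith, by ring, rfl⟩
  have hv := hF.left_mem_of_mem_openSegment hvQ (hPQ hp) hq hseg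
  have hpF := hF.right_mem_of_mem_openSegment hvQ (hPQ hp) hq hseg
  have hpFP : p ∈ F ∩ P := ⟨hpF, hp⟩
  exact Or.inr ⟨hv, segment_subset_convexHull (Set.mem_insert _ _)
    (Set.mem_insert_of_mem _ hpFP) (openSegment_subset_segment ℝ _ _ hseg)⟩

theorem isExtreme_convexHull_insert {E : Type*} [AddCommGroup E] [Module ℝ E]
    {P G : Set E} (hP : Convex ℝ P) (hG : IsExtreme ℝ P G) (hGc : Convex ℝ G) {v : E}
    {f : E →ₗ[ℝ] ℝ} {c : ℝ} (hf : ∀ p ∈ P, f p = c) (hv : f v = c + 1) :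
    IsExtreme ℝ (convexHull ℝ (insert v P)) (convexHull ℝ (insert v G)) := by
  refine ⟨convexHull_mono (Set.insert_subset_insert hG.subset), fun q₁ hq₁ q₂ hq₂ q hq hq' => ?_⟩
  rcases (mem_convexHull_insert_iff hP).1 hq₁ with rfl | ⟨p₁, hp₁, t₁, ht₁, ht₁', rfl⟩
  · exact mem_convexHull_insert_self q₁ G
  obtain ⟨a, b, ha, hb, hab, rfl⟩ := hq'
  suffices hp : p₁ ∈ G from (mem_convexHull_insert_iff hGc).2 (.inr ⟨p₁, hp, t₁, ht₁, ht₁', rfl⟩)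
  rcases (mem_convexHull_insert_iff hGc).1 hq with h | ⟨g, hg, t, ht, ht', h⟩ <;>
  rcases (mem_convexHull_insert_iff hP).1 hq₂ with rfl | ⟨p₂, hp₂, t₂, ht₂, ht₂', rfl⟩
  · have := congrArg f h
    simp only [map_add, map_smul, smul_eq_mul, hf _ hp₁, hv] at this
    obtain rfl : b = 1 - a := by linarith
    linarith [mul_pos ha (sub_pos.2 ht₁')]
  · have := congrArg f h
    simp only [map_add, map_smul, smul_eq_mul, hf _ hp₁, hf _ hp₂, hv] at this
    obtain rfl : b = 1 - a := by linarith
    linarith [mul_pos ha (sub_pos.2 ht₁'), mul_pos hb (sub_pos.2 ht₂')]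
  · have h1 := congrArg f h
    simp only [map_add, map_smul, smul_eq_mul, hf _ hp₁, hf _ (hG.subset hg), hv] at h1
    have h2 : 1 - t = a * (1 - t₁) := by linear_combination h1 - c * hab - hab
    have h3 : (1 - t) • p₁ = (1 - t) • g := by
      obtain rfl : t = 1 - a * (1 - t₁) := by linarith
      obtain rfl : b = 1 - a := by linarith
      rw [eq_sub_of_add_eq' h.symm]
      module
    rwa [smul_right_injective E (sub_pos.2 ht').ne' h3]
  · have h1 := congrArg f h
    simp only [map_add, map_smul, smul_eq_mul, hf _ hp₁, hf _ hp₂, hf _ (hG.subset hg), hv] at h1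
    have hs := sub_pos.2 ht'
    have h2 : 1 - t = a * (1 - t₁) + b * (1 - t₂) := by
      linear_combination h1 - c * hab - hab
    refine hG.left_mem_of_mem_openSegment hp₁ hp₂ hg ⟨a * (1 - t₁) / (1 - t),
      b * (1 - t₂) / (1 - t), div_pos (mul_pos ha (sub_pos.2 ht₁')) hs,
      div_pos (mul_pos hb (sub_pos.2 ht₂')) hs, by rw [← add_div, ← h2, div_self hs.ne'], ?_⟩
    apply smul_right_injective E hs.ne'
    simp only [smul_add, smul_smul, mul_div_cancel₀ _ hs.ne']
    have : t = a * t₁ + b * t₂ := by linear_combination -h2 - hab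
    rw [eq_sub_of_add_eq' h.symm, this]
    module

theorem isExtreme_convexHull_insert_base {E : Type*} [AddCommGroup E] [Module ℝ E]
    {P : Set E} (hP : Convex ℝ P) {v : E}
    {f : E →ₗ[ℝ] ℝ} {c : ℝ} (hf : ∀ p ∈ P, f p = c) (hv : f v = c + 1) :
    IsExtreme ℝ (convexHull ℝ (insert v P)) P := by
  have key : ∀ q ∈ convexHull ℝ (insert v P), c ≤ f q ∧ (f q = c → q ∈ P) := by
    intro q hq
    rcases (mem_convexHull_insert_iff hP).1 hq with rfl | ⟨p, hp, t, ht, ht', rfl⟩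
    · exact ⟨by linarith, fun h => by linarith⟩
    · simp only [map_add, map_smul, smul_eq_mul, hf _ hp, hv]
      refine ⟨by linarith, fun h => ?_⟩
      obtain rfl : t = 0 := by linarith
      simpa using hp
  refine ⟨subset_convexHull_insert v P, fun q₁ hq₁ q₂ hq₂ q hq hq' => ?_⟩
  obtain ⟨a, b, ha, hb, hab, rfl⟩ := hq'
  have h := hf _ hq
  simp only [map_add, map_smul, smul_eq_mul] at h
  refine (key q₁ hq₁).2 (le_antisymm ?_ (key q₁ hq₁).1)
  have := mul_le_mul_of_nonneg_left (key q₂ hq₂).1 hb.le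
  have h3 : a * f q₁ ≤ a * c := by
    have : c = a * c + b * c := by rw [← add_mul, hab, one_mul]
    linarith
  exact le_of_mul_le_mul_left h3 ha

theorem convexHull_insert_inter_base {E : Type*} [AddCommGroup E] [Module ℝ E]
    {P G : Set E} (hGP : G ⊆ P) (hGc : Convex ℝ G) {v : E}
    {f : E →ₗ[ℝ] ℝ} {c : ℝ} (hf : ∀ p ∈ P, f p = c) (hv : f v = c + 1) :
    convexHull ℝ (insert v G) ∩ P = G := by
  refine Set.Subset.antisymm ?_ (Set.subset_inter (subset_convexHull_insert v G) hGP)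
  rintro q ⟨hq, hqP⟩
  have h := hf _ hqP
  rcases (mem_convexHull_insert_iff hGc).1 hq with rfl | ⟨p, hp, t, ht, ht', rfl⟩
  · linarith
  · simp only [map_add, map_smul, smul_eq_mul, hf _ (hGP hp), hv] at h
    obtain rfl : t = 0 := by linarith
    simpa using hp

instance {d : ℕ} (P : Set (Fin d → ℝ)) : PartialOrder (Faces P) :=
  inferInstanceAs (PartialOrder {F : Set (Fin d → ℝ) // IsExtreme ℝ P F ∧ Convex ℝ F})

/-- The trace of a face of `Q` on a convex subset `P`. -/
def Faces.trace {d : ℕ} {Q P : Set (Fin d → ℝ)} (hP : Convex ℝ P) (hPQ : P ⊆ Q)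
    (F : Faces Q) : Faces P :=
  ⟨F.1 ∩ P, ⟨Set.inter_subset_right, fun _ hx _ hy _ hz h =>
    ⟨F.2.1.left_mem_of_mem_openSegment (hPQ hx) (hPQ hy) hz.1 h, hx⟩⟩, F.2.2.inter hP⟩

theorem mem_convexHull_insert_iff_of_nonempty {E : Type*} [AddCommGroup E] [Module ℝ E]
    {G : Set E} (hG : Convex ℝ G) (hne : G.Nonempty) {v q : E} :
    q ∈ convexHull ℝ (insert v G) ↔
      ∃ g ∈ G, ∃ t : ℝ, 0 ≤ t ∧ t ≤ 1 ∧ q = t • v + (1 - t) • g := by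
  rw [mem_convexHull_insert_iff hG]
  constructor
  · rintro (rfl | ⟨g, hg, t, ht, ht', rfl⟩)
    · obtain ⟨g, hg⟩ := hne
      exact ⟨g, hg, 1, zero_le_one, le_rfl, by simp⟩
    · exact ⟨g, hg, t, ht, ht'.le, rfl⟩
  · rintro ⟨g, hg, t, ht, ht', rfl⟩
    rcases ht'.eq_or_lt with rfl | ht'
    · simp
    · exact Or.inr ⟨g, hg, t, ht, ht', rfl⟩

theorem Convex.add_smul_mem_three {E : Type*} [AddCommGroup E] [Module ℝ E] {S : Set E}
    (hS : Convex ℝ S) {u v w : E} (hu : u ∈ S) (hv : v ∈ S) (hw : w ∈ S) {a b c : ℝ}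
    (ha : 0 ≤ a) (hb : 0 ≤ b) (hc : 0 ≤ c) (habc : a + b + c = 1) :
    a • u + b • v + c • w ∈ S := by
  have := hS.sum_mem (t := Finset.univ) (w := ![a, b, c]) (z := ![u, v, w])
    (by intro i _; fin_cases i <;> simpa) (by simpa [Fin.sum_univ_three] using habc)
    (by intro i _; fin_cases i <;> simpa)
  simpa [Fin.sum_univ_three] using this

theorem IsExtreme.mem_of_smul_eq {E : Type*} [AddCommGroup E] [Module ℝ E] {P G : Set E}
    (hG : IsExtreme ℝ P G) (hP : Convex ℝ P) {g z p₁ p₂ : E} (hg : g ∈ G) (hz : z ∈ P)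
    (hp₁ : p₁ ∈ P) (hp₂ : p₂ ∈ P) {l m n : ℝ} (hl : 0 < l) (hm : 0 ≤ m) (hn : 0 ≤ n)
    (h : (l + m + n) • g = l • z + m • p₁ + n • p₂) : z ∈ G := by
  rcases (add_nonneg hm hn).eq_or_lt with hmn | hmn
  · obtain rfl : m = 0 := by linarith
    obtain rfl : n = 0 := by linarith
    simp only [add_zero, zero_smul] at h
    rwa [← smul_right_injective E hl.ne' h]
  · have hs : 0 < l + m + n := by linarith
    have hw : (m / (m + n)) • p₁ + (n / (m + n)) • p₂ ∈ P :=
      hP hp₁ hp₂ (by positivity) (by positivity) (by field_simp)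
    refine hG.left_mem_of_mem_openSegment hz hw hg ⟨l / (l + m + n), (m + n) / (l + m + n),
      by positivity, by positivity, by field_simp; ring, ?_⟩
    apply smul_right_injective E hs.ne'
    simp only
    rw [h]
    match_scalars <;> field_simp

/-- The position of the vertices `x`, `y` of a bipyramid relative to its base `P`: the open
segment from `x` to `y` crosses `P` in the relatively interior point `z`. -/
structure BipyramidPosition {d : ℕ} (P : Set (Fin d → ℝ)) (x y z : Fin d → ℝ) : Prop where
  convex : Convex ℝ P
  left_notMem : x ∉ affineSpan ℝ P
  right_notMem : y ∉ affineSpan ℝ P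
  mem_openSegment : z ∈ openSegment ℝ x y
  mem : z ∈ P
  exists_mem_openSegment : ∀ p ∈ P, ∃ p' ∈ P, z ∈ openSegment ℝ p p'

namespace BipyramidPosition

variable {d : ℕ} {P G : Set (Fin d → ℝ)} {x y z : Fin d → ℝ}

theorem symm (h : BipyramidPosition P x y z) : BipyramidPosition P y x z :=
  ⟨h.convex, h.right_notMem, h.left_notMem, by rw [openSegment_symm]; exact h.mem_openSegment,
    h.mem, h.exists_mem_openSegment⟩

theorem subset_of_mem (h : BipyramidPosition P x y z) (hG : IsExtreme ℝ P G) (hz : z ∈ G) :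
    P ⊆ G := fun p hp => by
  obtain ⟨p', hp', hzp⟩ := h.exists_mem_openSegment p hp
  exact hG.left_mem_of_mem_openSegment hp hp' hz hzp

theorem mem_convexHull_left_or_right (h : BipyramidPosition P x y z) {q : Fin d → ℝ}
    (hq : q ∈ convexHull ℝ (insert x (insert y P))) :
    q ∈ convexHull ℝ (insert x P) ∨ q ∈ convexHull ℝ (insert y P) := by
  replace hq := convexHull_mono (Set.insert_subset_insert (subset_convexHull ℝ (insert y P))) hq
  obtain ⟨w, hw, t, ht, ht', rfl⟩ := (mem_convexHull_insert_iff_of_nonempty (convex_convexHull ℝ _)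
    ⟨y, mem_convexHull_insert_self y P⟩).1 hq
  obtain ⟨p, hp, s, hs, hs', rfl⟩ :=
    (mem_convexHull_insert_iff_of_nonempty h.convex ⟨z, h.mem⟩).1 hw
  obtain ⟨α, β, hα, hβ, hαβ, hz⟩ := h.mem_openSegment
  have hC : 0 ≤ (1 - t) * (1 - s) := mul_nonneg (by linarith) (by linarith)
  have hB : 0 ≤ (1 - t) * s := mul_nonneg (by linarith) hs
  rcases le_total (((1 - t) * s) * α) (t * β) with hle | hle
  · left
    obtain ⟨k, hk⟩ : ∃ k, (1 - t) * s = k * β := ⟨(1 - t) * s / β, by field_simp⟩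
    have hk0 : 0 ≤ k := nonneg_of_mul_nonneg_left (hk ▸ hB) hβ
    have hk1 : 0 ≤ t - k * α := by
      refine nonneg_of_mul_nonneg_left (b := β) ?_ hβ
      rw [hk] at hle
      linarith
    have := (convex_convexHull ℝ (insert x P)).add_smul_mem_three
      (mem_convexHull_insert_self x P) (subset_convexHull_insert x P h.mem)
      (subset_convexHull_insert x P hp) hk1 hk0 hC (by linear_combination -k * hαβ - hk)
    convert this using 1
    rw [← hz]
    match_scalars <;> first | ring1 | linear_combination hk
  · right
    obtain ⟨k, hk⟩ : ∃ k, t = k * α := ⟨t / α, by field_simp⟩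
    have hk0 : 0 ≤ k := nonneg_of_mul_nonneg_left (hk ▸ ht) hα
    have hk1 : 0 ≤ (1 - t) * s - k * β := by
      refine nonneg_of_mul_nonneg_left (b := α) ?_ hα
      have : t * β = k * α * β := by rw [← hk]
      linarith
    have := (convex_convexHull ℝ (insert y P)).add_smul_mem_three
      (mem_convexHull_insert_self y P) (subset_convexHull_insert y P h.mem)
      (subset_convexHull_insert y P hp) hk1 hk0 hC (by linear_combination -k * hαβ - hk)
    convert this using 1
    rw [← hz]
    match_scalars <;> first | ring1 | linear_combination hk

theorem left_mem_convexHull (h : BipyramidPosition P x y z) (hG : IsExtreme ℝ P G)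
    (hGc : Convex ℝ G) (hzG : z ∉ G) {q₁ q₂ q : Fin d → ℝ}
    (hq₁ : q₁ ∈ convexHull ℝ (insert x (insert y P)))
    (hq₂ : q₂ ∈ convexHull ℝ (insert x (insert y P)))
    (hq : q ∈ convexHull ℝ (insert x G)) (hseg : q ∈ openSegment ℝ q₁ q₂) :
    q₁ ∈ convexHull ℝ (insert x P) := by
  by_contra hcon
  have hne : P.Nonempty := ⟨z, h.mem⟩
  obtain ⟨p₁, hp₁, t, ht, ht', rfl⟩ := (mem_convexHull_insert_iff_of_nonempty h.convex hne).1
    ((h.mem_convexHull_left_or_right hq₁).resolve_left hcon)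
  replace ht : 0 < t := by
    refine ht.lt_of_ne' ?_
    rintro rfl
    exact hcon (by simpa using subset_convexHull_insert x P hp₁)
  obtain ⟨f, c, hf, hx⟩ := exists_linearMap_of_notMem_affineSpan h.left_notMem
  obtain ⟨α, β, hα, hβ, hαβ, hz⟩ := h.mem_openSegment
  have hy : β * (f y - c) = -α := by
    have := hf _ h.mem
    simp only [← hz, map_add, map_smul, smul_eq_mul, hx] at this
    linear_combination this - c * hαβ
  have hy' : f y - c < 0 := neg_of_mul_neg_right (hy ▸ neg_neg_of_pos hα) hβ.le
  obtain ⟨a, b, ha, hb, hab, rfl⟩ := hseg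
  rcases h.mem_convexHull_left_or_right hq₂ with hq₂ | hq₂ <;>
  obtain ⟨p₂, hp₂, s, hs, hs', rfl⟩ :=
    (mem_convexHull_insert_iff_of_nonempty h.convex hne).1 hq₂
  · obtain ⟨k, hk⟩ : ∃ k, a * t = k * β := ⟨a * t / β, by field_simp⟩
    have hk0 : 0 < k := pos_of_mul_pos_left (hk ▸ mul_pos ha ht) hβ.le
    have hsum : 0 < k + a * (1 - t) + b * (1 - s) := by
      have := mul_nonneg ha.le (sub_nonneg.2 ht')
      have := mul_nonneg hb.le (sub_nonneg.2 hs')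
      linarith
    rcases (mem_convexHull_insert_iff hGc).1 hq with hq | ⟨g, hg, r, hr, hr', hq⟩
    · have hfq := congrArg f hq
      simp only [map_add, map_smul, smul_eq_mul, hf _ hp₁, hf _ hp₂, hx] at hfq
      refine hsum.ne' ?_
      linear_combination -hfq + k * hy + (f y - c) * hk + c * hab + hab - k * hαβ - hk
    · have hfq := congrArg f hq
      simp only [map_add, map_smul, smul_eq_mul, hf _ hp₁, hf _ hp₂, hf _ (hG.subset hg), hx]
        at hfq
      refine hzG (hG.mem_of_smul_eq h.convex hg h.mem hp₁ hp₂ hk0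
        (mul_nonneg ha.le (sub_nonneg.2 ht')) (mul_nonneg hb.le (sub_nonneg.2 hs')) ?_)
      have hr1 : k + a * (1 - t) + b * (1 - s) = 1 - r := by
        linear_combination -hfq + k * hy + (f y - c) * hk + c * hab + hab - k * hαβ - hk
      have hr2 : r = b * s - k * α := by
        linear_combination -hfq + k * hy + (f y - c) * hk + c * hab
      rw [hr1, eq_sub_of_add_eq' hq.symm, hr2, ← hz]
      match_scalars <;> first | ring1 | linear_combination hk
  · have hfq : c ≤ f (a • (t • y + (1 - t) • p₁) + b • (s • y + (1 - s) • p₂)) := by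
      rcases (mem_convexHull_insert_iff hGc).1 hq with hq | ⟨g, hg, r, hr, hr', hq⟩
      · rw [hq, hx]; linarith
      · rw [hq]
        simp only [map_add, map_smul, smul_eq_mul, hf _ (hG.subset hg), hx]
        linarith
    simp only [map_add, map_smul, smul_eq_mul, hf _ hp₁, hf _ hp₂] at hfq
    have h1 : 0 < a * t + b * s := add_pos_of_pos_of_nonneg (mul_pos ha ht) (mul_nonneg hb.le hs)
    have h2 := mul_neg_of_pos_of_neg h1 hy'
    have h3 : c = a * c + b * c := by rw [← add_mul, hab, one_mul]
    linarith

theorem isExtreme_convexHull_insert_left (h : BipyramidPosition P x y z)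
    (hG : IsExtreme ℝ P G) (hGc : Convex ℝ G) (hzG : z ∉ G) :
    IsExtreme ℝ (convexHull ℝ (insert x (insert y P))) (convexHull ℝ (insert x G)) := by
  obtain ⟨f, c, hf, hx⟩ := exists_linearMap_of_notMem_affineSpan h.left_notMem
  refine ⟨convexHull_mono (Set.insert_subset_insert (hG.subset.trans (Set.subset_insert y P))),
    fun q₁ hq₁ q₂ hq₂ q hq hseg => ?_⟩
  exact (isExtreme_convexHull_insert h.convex hG hGc hf hx).left_mem_of_mem_openSegment
    (h.left_mem_convexHull hG hGc hzG hq₁ hq₂ hq hseg)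
    (h.left_mem_convexHull hG hGc hzG hq₂ hq₁ hq (by rwa [openSegment_symm])) hq hseg

theorem isExtreme_convexHull_insert_right (h : BipyramidPosition P x y z)
    (hG : IsExtreme ℝ P G) (hGc : Convex ℝ G) (hzG : z ∉ G) :
    IsExtreme ℝ (convexHull ℝ (insert x (insert y P))) (convexHull ℝ (insert y G)) := by
  rw [Set.insert_comm]
  exact h.symm.isExtreme_convexHull_insert_left hG hGc hzG

theorem isExtreme_convexHull (h : BipyramidPosition P x y z)
    (hG : IsExtreme ℝ P G) (hGc : Convex ℝ G) (hzG : z ∉ G) :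
    IsExtreme ℝ (convexHull ℝ (insert x (insert y P))) G := by
  obtain ⟨f, c, hf, hx⟩ := exists_linearMap_of_notMem_affineSpan h.left_notMem
  exact (h.isExtreme_convexHull_insert_left hG hGc hzG).trans
    (isExtreme_convexHull_insert_base hGc (fun p hp => hf p (hG.subset hp)) hx)

theorem isExtreme_singleton_right (h : BipyramidPosition P x y z) :
    IsExtreme ℝ (convexHull ℝ (insert x (insert y P))) {y} := by
  have := h.isExtreme_convexHull_insert_right (G := ∅) ⟨Set.empty_subset _, by simp⟩
    convex_empty (Set.notMem_empty z)
  simpa using this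

theorem convexHull_subset_of_mem (h : BipyramidPosition P x y z) {F : Set (Fin d → ℝ)}
    (hF : IsExtreme ℝ (convexHull ℝ (insert x (insert y P))) F) (hFc : Convex ℝ F)
    (hz : z ∈ F) : convexHull ℝ (insert x (insert y P)) ⊆ F := by
  have hQ := subset_convexHull ℝ (insert x (insert y P))
  have hx : x ∈ convexHull ℝ (insert x (insert y P)) := hQ (Set.mem_insert _ _)
  have hy : y ∈ convexHull ℝ (insert x (insert y P)) :=
    hQ (Set.mem_insert_of_mem _ (Set.mem_insert _ _))
  refine convexHull_min (Set.insert_subset ?_ (Set.insert_subset ?_ fun p hp => ?_)) hFc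
  · exact hF.left_mem_of_mem_openSegment hx hy hz h.mem_openSegment
  · exact hF.right_mem_of_mem_openSegment hx hy hz h.mem_openSegment
  · obtain ⟨p', hp', hzp⟩ := h.exists_mem_openSegment p hp
    exact hF.left_mem_of_mem_openSegment (hQ (.inr (.inr hp))) (hQ (.inr (.inr hp'))) hz hzp

theorem mem_of_left_mem_of_right_mem (h : BipyramidPosition P x y z) {F : Set (Fin d → ℝ)}
    (hFc : Convex ℝ F) (hx : x ∈ F) (hy : y ∈ F) : z ∈ F :=
  hFc.openSegment_subset hx hy h.mem_openSegment

theorem right_mem_of_isPyramidOver (h : BipyramidPosition P x y z) (hP : IsPolytope P)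
    (hP₂ : P.Nontrivial) {F : Set (Fin d → ℝ)} (hFc : Convex ℝ F) {v : Fin d → ℝ}
    (hv : v ∉ affineSpan ℝ F)
    (hQ : convexHull ℝ (insert x (insert y P)) = convexHull ℝ (insert v F)) : y ∈ F := by
  obtain ⟨f, c, hf, hfv⟩ := exists_linearMap_of_notMem_affineSpan hv
  have hvF : v ∉ F := fun hvF => hv (subset_affineSpan ℝ F hvF)
  have hF := isExtreme_convexHull_insert_base hFc hf hfv
  have eq_or_mem : ∀ e, IsExtreme ℝ (convexHull ℝ (insert v F)) {e} → e = v ∨ e ∈ F := by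
    intro e he
    have heQ := he.subset (Set.mem_singleton e)
    rcases he.mem_and_mem_of_mem_convexHull_insert hFc (mem_convexHull_insert_self v F)
      (subset_convexHull_insert v F) rfl heQ with h | ⟨h, -⟩
    · exact Or.inr h
    · exact Or.inl h.symm
  refine (eq_or_mem y (hQ ▸ h.isExtreme_singleton_right)).resolve_left ?_
  rintro rfl
  obtain ⟨e, he, heF⟩ : ∃ e ∈ P.extremePoints ℝ, e ∉ F := by
    by_contra! hcon
    have hPF : P ⊆ F := by
      obtain ⟨s, rfl⟩ := hP
      have hfin : ((convexHull ℝ (s : Set (Fin d → ℝ))).extremePoints ℝ).Finite :=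
        s.finite_toSet.subset extremePoints_convexHull_subset
      rw [← closure_convexHull_extremePoints (s.finite_toSet.isCompact_convexHull ℝ)
        (convex_convexHull ℝ _), (hfin.isClosed_convexHull ℝ).closure_eq]
      exact convexHull_min hcon hFc
    rw [← hQ] at hF
    refine hvF (h.convexHull_subset_of_mem hF hFc (hPF h.mem) ?_)
    rw [hQ]
    exact mem_convexHull_insert_self y F
  rw [← isExtreme_singleton] at he
  have hze : z ∉ ({e} : Set (Fin d → ℝ)) := fun hze =>
    hP₂.not_subset_singleton (h.subset_of_mem he hze)
  rcases eq_or_mem e (hQ ▸ h.isExtreme_convexHull he (convex_singleton e) hze) with rfl | he'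
  · exact h.right_notMem (subset_affineSpan ℝ P (he.subset rfl))
  · exact heF he'

end BipyramidPosition

theorem eventually_lineMap_mem_intrinsicInterior {d : ℕ} {S : Set (Fin d → ℝ)}
    {z w : Fin d → ℝ} (hz : z ∈ intrinsicInterior ℝ S) (hw : w ∈ affineSpan ℝ S) :
    ∀ᶠ t in nhds (0 : ℝ), AffineMap.lineMap z w t ∈ intrinsicInterior ℝ S := by
  obtain ⟨z', hz', rfl⟩ := mem_intrinsicInterior.1 hz
  let g : ℝ → affineSpan ℝ S := fun t =>
    ⟨AffineMap.lineMap (z' : Fin d → ℝ) w t, AffineMap.lineMap_mem t z'.2 hw⟩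
  have hg : Continuous g := by
    refine Continuous.subtype_mk ?_ _
    exact AffineMap.lineMap_continuous
  have hg0 : g 0 = z' := Subtype.ext (AffineMap.lineMap_apply_zero _ _)
  have : ∀ᶠ t in nhds (0 : ℝ), g t ∈ interior ((↑) ⁻¹' S : Set (affineSpan ℝ S)) :=
    hg.continuousAt.eventually_mem (isOpen_interior.mem_nhds (hg0.symm ▸ hz'))
  filter_upwards [this] with t ht
  exact mem_intrinsicInterior.2 ⟨g t, ht, rfl⟩

theorem exists_mem_openSegment_of_mem_intrinsicInterior {d : ℕ} {S : Set (Fin d → ℝ)}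
    {z p : Fin d → ℝ} (hz : z ∈ intrinsicInterior ℝ S) (hp : p ∈ S) :
    ∃ p' ∈ S, z ∈ openSegment ℝ p p' := by
  have h := eventually_lineMap_mem_intrinsicInterior hz (subset_affineSpan ℝ S hp)
  obtain ⟨t, ht, ht0⟩ := ((h.filter_mono nhdsWithin_le_nhds).and
    (self_mem_nhdsWithin (s := Set.Iio (0 : ℝ)))).exists
  replace ht0 : t < 0 := ht0
  have hs : 0 < 1 - t := by linarith
  refine ⟨_, intrinsicInterior_subset ht, -t / (1 - t), 1 / (1 - t),
    div_pos (neg_pos.2 ht0) hs, by positivity, by field_simp; ring, ?_⟩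
  rw [AffineMap.lineMap_apply_module]
  match_scalars <;> field_simp
  ring

theorem left_notMem_intrinsicInterior_segment {d : ℕ} {x y : Fin d → ℝ} (hxy : x ≠ y) :
    x ∉ intrinsicInterior ℝ (segment ℝ x y) := by
  intro hx
  obtain ⟨p, ⟨s, t, -, ht, hst, rfl⟩, a, b, ha, hb, hab, h⟩ :=
    exists_mem_openSegment_of_mem_intrinsicInterior hx (right_mem_segment ℝ x y)
  have h0 : (a + b * t) • (y - x) = 0 := by
    rw [← sub_eq_zero] at h
    rw [← h]
    obtain rfl : s = 1 - t := by linarith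
    obtain rfl : a = 1 - b := by linarith
    module
  rcases smul_eq_zero.1 h0 with h0 | h0
  · exact (add_pos_of_pos_of_nonneg ha (mul_nonneg hb.le ht)).ne' h0
  · exact hxy (sub_eq_zero.1 h0).symm

theorem exists_bipyramidPosition {d : ℕ} {P Q : Set (Fin d → ℝ)} (hP : Convex ℝ P)
    (h : IsBipyramidOver Q P) :
    ∃ x y z, BipyramidPosition P x y z ∧ Q = convexHull ℝ (insert x (insert y P)) := by
  obtain ⟨x, y, z, hxy, hz, rfl⟩ := h
  obtain ⟨hzs, hzP⟩ : z ∈ intrinsicInterior ℝ (segment ℝ x y) ∩ intrinsicInterior ℝ P :=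
    hz ▸ rfl
  have hzx : x ≠ z := by
    rintro rfl
    exact left_notMem_intrinsicInterior_segment hxy hzs
  have hzy : y ≠ z := by
    rintro rfl
    rw [segment_symm] at hzs
    exact left_notMem_intrinsicInterior_segment hxy.symm hzs
  have notMem : ∀ w ∈ segment ℝ x y, w ≠ z → w ∉ affineSpan ℝ P := by
    intro w hw hwz hwP
    have h₁ := eventually_lineMap_mem_intrinsicInterior hzs (subset_affineSpan ℝ _ hw)
    have h₂ := eventually_lineMap_mem_intrinsicInterior hzP hwP
    obtain ⟨t, ht, ht0⟩ := (((h₁.and h₂).filter_mono nhdsWithin_le_nhds).and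
      (self_mem_nhdsWithin (s := Set.Iio (0 : ℝ)))).exists
    have htz : AffineMap.lineMap z w t = z := by
      rw [← Set.mem_singleton_iff, ← hz]
      exact ht
    rcases AffineMap.lineMap_eq_left_iff.1 htz with h | h
    · exact hwz h.symm
    · exact (ne_of_lt ht0) h
  exact ⟨x, y, z, ⟨hP, notMem x (left_mem_segment ℝ x y) hzx,
    notMem y (right_mem_segment ℝ x y) hzy,
    mem_openSegment_of_ne_left_right hzx hzy (intrinsicInterior_subset hzs),
    intrinsicInterior_subset hzP,
    fun p hp => exists_mem_openSegment_of_mem_intrinsicInterior hzP hp⟩, rfl⟩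

theorem not_isPyramidOver_of_isBipyramidOver {d : ℕ} {P Q F : Set (Fin d → ℝ)}
    (hP : IsPolytope P) (hP₂ : P.Nontrivial) (hQ : IsBipyramidOver Q P) (hF : IsPolytope F) :
    ¬ IsPyramidOver Q F := by
  rintro ⟨v, hv, hQF⟩
  have hPc : Convex ℝ P := by obtain ⟨s, rfl⟩ := hP; exact convex_convexHull ℝ _
  have hFc : Convex ℝ F := by obtain ⟨s, rfl⟩ := hF; exact convex_convexHull ℝ _
  obtain ⟨x, y, z, h, rfl⟩ := exists_bipyramidPosition hPc hQ
  obtain ⟨f, c, hf, hfv⟩ := exists_linearMap_of_notMem_affineSpan hv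
  have hx := h.symm.right_mem_of_isPyramidOver hP hP₂ hFc hv (by rw [Set.insert_comm, hQF])
  have hy := h.right_mem_of_isPyramidOver hP hP₂ hFc hv hQF
  have hFe := isExtreme_convexHull_insert_base hFc hf hfv
  have hvQ := mem_convexHull_insert_self v F
  rw [← hQF] at hFe hvQ
  exact hv (subset_affineSpan ℝ F (h.convexHull_subset_of_mem hFe hFc
    (h.mem_of_left_mem_of_right_mem hFc hx hy) hvQ))

/-- The top element of the face poset of a convex set: the whole set. -/
abbrev Faces.orderTop {d : ℕ} {P : Set (Fin d → ℝ)} (hP : Convex ℝ P) : OrderTop (Faces P) where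
  top := ⟨P, IsExtreme.refl ℝ P, hP⟩
  le_top F := F.2.1.subset

theorem nonempty_faces_singleton_orderIso {d : ℕ} (y : Fin d → ℝ) :
    Nonempty (Faces ({y} : Set (Fin d → ℝ)) ≃o Prop) := by
  let φ : Faces ({y} : Set (Fin d → ℝ)) → Prop := fun F => y ∈ F.1
  have hφ : ∀ F G, φ F ≤ φ G ↔ F ≤ G := fun F G => by
    refine ⟨fun h q hq => ?_, fun h hy => h hy⟩
    obtain rfl : q = y := F.2.1.subset hq
    exact h hq
  refine ⟨RelIso.ofSurjective (OrderEmbedding.ofMapLEIff φ hφ) fun b => ?_⟩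
  by_cases hb : b
  · exact ⟨⟨{y}, IsExtreme.refl ℝ _, convex_singleton y⟩, propext ⟨fun _ => hb, fun _ => rfl⟩⟩
  · exact ⟨⟨∅, ⟨Set.empty_subset _, by simp⟩, convex_empty⟩, propext ⟨False.elim, hb⟩⟩

theorem nonempty_faces_pyramid_orderIso {d : ℕ} {P : Set (Fin d → ℝ)} (hP : Convex ℝ P)
    {v : Fin d → ℝ} (hv : v ∉ affineSpan ℝ P) :
    Nonempty (Faces (convexHull ℝ (insert v P)) ≃o Faces P × Prop) := by
  obtain ⟨f, c, hf, hfv⟩ := exists_linearMap_of_notMem_affineSpan hv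
  have hPQ := subset_convexHull_insert v P
  let φ : Faces (convexHull ℝ (insert v P)) → Faces P × Prop :=
    fun F => (F.trace hP hPQ, v ∈ F.1)
  have hφ : ∀ F G, φ F ≤ φ G ↔ F ≤ G := fun F G => by
    refine ⟨fun h q hq => ?_, fun h => ⟨Set.inter_subset_inter_left P h, fun hvF => h hvF⟩⟩
    rcases F.2.1.mem_and_mem_of_mem_convexHull_insert hP (mem_convexHull_insert_self v P) hPQ hq
      (F.2.1.subset hq) with hqP | ⟨hvF, hq'⟩
    · exact (h.1 ⟨hq, hqP⟩).1
    · exact convexHull_min (Set.insert_subset (h.2 hvF) fun p hp => (h.1 hp).1) G.2.2 hq'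
  refine ⟨RelIso.ofSurjective (OrderEmbedding.ofMapLEIff φ hφ) fun ⟨G, b⟩ => ?_⟩
  by_cases hb : b
  · exact ⟨⟨convexHull ℝ (insert v G.1), isExtreme_convexHull_insert hP G.2.1 G.2.2 hf hfv,
      convex_convexHull ℝ _⟩, Prod.ext (Subtype.ext
        (convexHull_insert_inter_base G.2.1.subset G.2.2 hf hfv))
      (propext ⟨fun _ => hb, fun _ => mem_convexHull_insert_self v G.1⟩)⟩
  · exact ⟨⟨G.1, (isExtreme_convexHull_insert_base hP hf hfv).trans G.2.1, G.2.2⟩,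
      Prod.ext (Subtype.ext (Set.inter_eq_left.2 G.2.1.subset))
      (propext ⟨fun hvG => absurd (subset_affineSpan ℝ P (G.2.1.subset hvG)) hv,
        fun h => absurd h hb⟩)⟩

theorem BipyramidPosition.hasFacePoly {d : ℕ} {P : Set (Fin d → ℝ)} {x y z : Fin d → ℝ}
    (h : BipyramidPosition P x y z) {p : Polynomial ℤ} (hp : HasFacePoly (Faces P) p) :
    HasFacePoly (Faces (convexHull ℝ (insert x (insert y P))))
      (1 + (p - 1) * (Polynomial.X + 1)) := by
  let Q := convexHull ℝ (insert x (insert y P))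
  have hQ : insert x (insert y P) ⊆ Q := subset_convexHull ℝ _
  have hPQ : P ⊆ Q := fun q hq => hQ (.inr (.inr hq))
  let _ := Faces.orderTop h.convex
  let _ : OrderTop (Faces Q) := Faces.orderTop (convex_convexHull ℝ _)
  have notMem_of_ne_top : ∀ G : Faces P, G ≠ ⊤ → z ∉ G.1 := fun G hG hz =>
    hG (Subtype.ext (G.2.1.subset.antisymm (h.subset_of_mem G.2.1 hz)))
  have notMem_of_ne_top' : ∀ F : Faces Q, F ≠ ⊤ → z ∉ F.1 := fun F hF hz =>
    hF (Subtype.ext (F.2.1.subset.antisymm (h.convexHull_subset_of_mem F.2.1 F.2.2 hz)))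
  let φ : {F : Faces Q // F ≠ ⊤} → {G : Faces P // G ≠ ⊤} × {b : Prop × Prop // b ≠ ⊤} :=
    fun F => ⟨⟨F.1.trace h.convex hPQ, fun htop => notMem_of_ne_top' F.1 F.2
        ((congrArg Subtype.val htop).symm ▸ h.mem : z ∈ (F.1.trace h.convex hPQ).1).1⟩,
      ⟨(x ∈ F.1.1, y ∈ F.1.1), fun htop => notMem_of_ne_top' F.1 F.2
        (h.mem_of_left_mem_of_right_mem F.1.2.2 (of_eq_true (congrArg Prod.fst htop))
          (of_eq_true (congrArg Prod.snd htop)))⟩⟩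
  have hφ : ∀ F G, φ F ≤ φ G ↔ F ≤ G := by
    rintro ⟨F, hF⟩ ⟨G, hG⟩
    refine ⟨fun hle q hq => ?_, fun hle => ⟨Set.inter_subset_inter_left P hle,
      fun hx => hle hx, fun hy => hle hy⟩⟩
    have hFG : F.1 ∩ P ⊆ G.1 ∩ P := hle.1
    have hxFG : x ∈ F.1 → x ∈ G.1 := hle.2.1
    have hyFG : y ∈ F.1 → y ∈ G.1 := hle.2.2
    have key : ∀ v ∈ Q, (v ∈ F.1 → v ∈ G.1) → q ∈ convexHull ℝ (insert v P) → q ∈ G.1 := by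
      intro v hv hvFG hqv
      rcases F.2.1.mem_and_mem_of_mem_convexHull_insert h.convex hv hPQ hq hqv with
        hqP | ⟨hvF, hq'⟩
      · exact (hFG ⟨hq, hqP⟩).1
      · exact convexHull_min (Set.insert_subset (hvFG hvF)
          (hFG.trans Set.inter_subset_left)) G.2.2 hq'
    rcases h.mem_convexHull_left_or_right (F.2.1.subset hq) with hqx | hqy
    · exact key x (hQ (.inl rfl)) hxFG hqx
    · exact key y (hQ (.inr (.inl rfl))) hyFG hqy
  have key : ∀ (G : Faces P) (_ : G ≠ ⊤) (b : Prop × Prop) (_ : b ≠ ⊤), ∃ F : Faces Q,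
      F.1 ∩ P = G.1 ∧ (x ∈ F.1 ↔ b.1) ∧ (y ∈ F.1 ↔ b.2) := by
    intro G hG b hb
    have hz := notMem_of_ne_top G hG
    have hPG := G.2.1.subset
    obtain ⟨f, c, hf, hfx⟩ := exists_linearMap_of_notMem_affineSpan h.left_notMem
    obtain ⟨g, c', hg, hgy⟩ := exists_linearMap_of_notMem_affineSpan h.right_notMem
    have hGx := convexHull_insert_inter_base hPG G.2.2 hf hfx
    have hGy := convexHull_insert_inter_base hPG G.2.2 hg hgy
    by_cases hbx : b.1 <;> by_cases hby : b.2
    · exact absurd (Prod.ext (eq_true hbx) (eq_true hby)) hb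
    · refine ⟨⟨_, h.isExtreme_convexHull_insert_left G.2.1 G.2.2 hz, convex_convexHull ℝ _⟩,
        hGx, iff_of_true (mem_convexHull_insert_self x G.1) hbx, iff_of_false (fun hy => hz ?_) hby⟩
      rw [← hGx]
      exact ⟨h.mem_of_left_mem_of_right_mem (convex_convexHull ℝ _)
        (mem_convexHull_insert_self x G.1) hy, h.mem⟩
    · refine ⟨⟨_, h.isExtreme_convexHull_insert_right G.2.1 G.2.2 hz, convex_convexHull ℝ _⟩,
        hGy, iff_of_false (fun hx => hz ?_) hbx, iff_of_true (mem_convexHull_insert_self y G.1) hby⟩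
      rw [← hGy]
      exact ⟨h.mem_of_left_mem_of_right_mem (convex_convexHull ℝ _) hx
        (mem_convexHull_insert_self y G.1), h.mem⟩
    · exact ⟨⟨G.1, h.isExtreme_convexHull G.2.1 G.2.2 hz, G.2.2⟩, Set.inter_eq_left.2 hPG,
        iff_of_false (fun hx => h.left_notMem (subset_affineSpan ℝ P (hPG hx))) hbx,
        iff_of_false (fun hy => h.right_notMem (subset_affineSpan ℝ P (hPG hy))) hby⟩
  refine HasFacePoly.of_proper_orderIso hp
    (RelIso.ofSurjective (OrderEmbedding.ofMapLEIff φ hφ) ?_)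
  rintro ⟨⟨G, hG⟩, ⟨b, hb⟩⟩
  obtain ⟨F, hFG, hx, hy⟩ := key G hG b hb
  refine ⟨⟨F, ?_⟩, Prod.ext (Subtype.ext (Subtype.ext hFG))
    (Subtype.ext (Prod.ext (propext hx) (propext hy)))⟩
  rintro rfl
  exact notMem_of_ne_top G hG (hFG ▸ ⟨hPQ h.mem, h.mem⟩)

theorem InP.convex {d : ℕ} {L : List Bool} {P : Set (Fin d → ℝ)} (h : InP L P) :
    Convex ℝ P := by
  cases h with
  | seg x y _ => exact convex_segment x y
  | pyr L P _ _ hQ => obtain ⟨v, -, rfl⟩ := hQ; exact convex_convexHull ℝ _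
  | bipyr L P _ _ hQ => obtain ⟨x, y, z, -, -, rfl⟩ := hQ; exact convex_convexHull ℝ _

theorem InP.hasFacePoly {d : ℕ} {L : List Bool} {P : Set (Fin d → ℝ)} (h : InP L P) :
    HasFacePoly (Faces P) (facePoly L) := by
  induction h with
  | seg x y hxy =>
    obtain ⟨e⟩ := nonempty_faces_singleton_orderIso y
    have hx : x ∉ affineSpan ℝ ({y} : Set (Fin d → ℝ)) := by
      rwa [AffineSubspace.mem_affineSpan_singleton]
    obtain ⟨e'⟩ := nonempty_faces_pyramid_orderIso (convex_singleton y) hx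
    rw [convexHull_pair] at e'
    exact ((hasFacePoly_prop.of_orderIso e).prod hasFacePoly_prop).of_orderIso e'
  | pyr L P Q hP hQ ih =>
    obtain ⟨v, hv, rfl⟩ := hQ
    obtain ⟨e⟩ := nonempty_faces_pyramid_orderIso hP.convex hv
    exact (ih.prod hasFacePoly_prop).of_orderIso e
  | bipyr L P Q hP hQ ih =>
    obtain ⟨x, y, z, h, rfl⟩ := exists_bipyramidPosition hP.convex hQ
    exact h.hasFacePoly ih

theorem InP.eq_of_combEquiv {d e : ℕ} {L₁ L₂ : List Bool} {P : Set (Fin d → ℝ)}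
    {Q : Set (Fin e → ℝ)} (hP : InP L₁ P) (hQ : InP L₂ Q) (h : CombEquiv P Q) : L₁ = L₂ := by
  obtain ⟨φ, hφ⟩ := h
  exact facePoly_injective (hP.hasFacePoly.unique hQ.hasFacePoly ⟨φ, (hφ _ _).symm⟩)

theorem InP.nonempty {d : ℕ} {L : List Bool} {P : Set (Fin d → ℝ)} (h : InP L P) :
    P.Nonempty := by
  cases h with
  | seg x y _ => exact ⟨x, left_mem_segment ℝ x y⟩
  | pyr L P _ _ hQ =>
    obtain ⟨v, -, rfl⟩ := hQ; exact ⟨v, mem_convexHull_insert_self v P⟩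
  | bipyr L P _ _ hQ =>
    obtain ⟨x, y, z, -, -, rfl⟩ := hQ; exact ⟨x, mem_convexHull_insert_self x _⟩

theorem finrank_vectorSpan_convexHull_insert_le {d : ℕ} (P : Set (Fin d → ℝ)) (v : Fin d → ℝ) :
    Module.finrank ℝ (vectorSpan ℝ (convexHull ℝ (insert v P))) ≤
      Module.finrank ℝ (vectorSpan ℝ P) + 1 := by
  rw [← direction_affineSpan, affineSpan_convexHull, direction_affineSpan]
  exact finrank_vectorSpan_insert_le_set ℝ P v

theorem InP.finrank_vectorSpan_le {d : ℕ} {L : List Bool} {P : Set (Fin d → ℝ)}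
    (h : InP L P) : Module.finrank ℝ (vectorSpan ℝ P) ≤ L.length + 1 := by
  induction h with
  | seg x y hxy =>
    rw [← convexHull_pair]
    have h := finrank_vectorSpan_convexHull_insert_le {y} x
    rwa [vectorSpan_singleton, finrank_bot] at h
  | pyr L P Q hP hQ ih =>
    obtain ⟨v, hv, rfl⟩ := hQ
    exact (finrank_vectorSpan_convexHull_insert_le P v).trans (Nat.succ_le_succ ih)
  | bipyr L P Q hP hQ ih =>
    obtain ⟨x, y, z, h, rfl⟩ := exists_bipyramidPosition hP.convex hQ
    have hx : x ∈ affineSpan ℝ (insert y P) := by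
      obtain ⟨a, b, ha, hb, hab, hz⟩ := h.mem_openSegment
      have hyz := AffineMap.lineMap_mem (1 / a) (subset_affineSpan ℝ _ (Set.mem_insert y P))
        (subset_affineSpan ℝ _ (Set.mem_insert_of_mem y h.mem))
      convert hyz using 1
      obtain rfl : b = 1 - a := by linarith
      rw [AffineMap.lineMap_apply_module, ← hz]
      match_scalars <;> field_simp
      ring
    have hle := finrank_vectorSpan_convexHull_insert_le P y
    rw [← direction_affineSpan, affineSpan_convexHull] at hle ⊢
    rw [affineSpan_insert_eq_affineSpan ℝ hx]
    exact hle.trans (Nat.succ_le_succ ih)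

theorem exists_notMem_vectorSpan_of_finrank_lt {d : ℕ} {P : Set (Fin d → ℝ)}
    (h : Module.finrank ℝ (vectorSpan ℝ P) < d) : ∃ w, w ∉ vectorSpan ℝ P := by
  by_contra! hcon
  rw [(Submodule.eq_top_iff'.2 hcon), finrank_top, Module.finrank_fin_fun] at h
  exact h.false

theorem intrinsicInterior_segment_add {d : ℕ} (a x y : Fin d → ℝ) :
    intrinsicInterior ℝ (segment ℝ (a + x) (a + y)) =
      (a + ·) '' intrinsicInterior ℝ (segment ℝ x y) := by
  rw [← segment_translate_image]
  exact (AffineIsometryEquiv.constVAdd ℝ (Fin d → ℝ) a).toAffineIsometry.intrinsicInterior_image _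

theorem exists_isPyramidOver {d : ℕ} {P : Set (Fin d → ℝ)} (hP : P.Nonempty)
    (h : Module.finrank ℝ (vectorSpan ℝ P) < d) : ∃ Q, IsPyramidOver Q P := by
  obtain ⟨w, hw⟩ := exists_notMem_vectorSpan_of_finrank_lt h
  obtain ⟨p, hp⟩ := hP
  refine ⟨_, p + w, fun hmem => hw ?_, rfl⟩
  rw [← direction_affineSpan]
  simpa using AffineSubspace.vsub_mem_direction hmem (subset_affineSpan ℝ P hp)

theorem exists_isBipyramidOver {d : ℕ} {P : Set (Fin d → ℝ)} (hPc : Convex ℝ P)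
    (hP : P.Nonempty) (h : Module.finrank ℝ (vectorSpan ℝ P) < d) :
    ∃ Q, IsBipyramidOver Q P := by
  obtain ⟨w, hw⟩ := exists_notMem_vectorSpan_of_finrank_lt h
  obtain ⟨z, hz⟩ := hP.intrinsicInterior hPc
  obtain ⟨c, hc⟩ := Set.Nonempty.intrinsicInterior (convex_segment (0 : Fin d → ℝ) w)
    ⟨0, left_mem_segment ℝ 0 w⟩
  have hzw : segment ℝ (0 : Fin d → ℝ) w ⊆ Submodule.span ℝ {w} :=
    (Submodule.span ℝ {w}).convex.segment_subset (zero_mem _) (Submodule.mem_span_singleton_self w)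
  have hw0 : w ≠ 0 := fun h0 => hw (h0 ▸ zero_mem _)
  refine ⟨_, (z - c) + 0, (z - c) + w, z, by simpa using hw0, ?_, rfl⟩
  rw [intrinsicInterior_segment_add]
  refine Set.Subset.antisymm ?_
    (Set.singleton_subset_iff.2 ⟨⟨c, hc, sub_add_cancel z c⟩, hz⟩)
  rintro _ ⟨⟨u, hu, rfl⟩, hu'⟩
  obtain ⟨t, ht⟩ := Submodule.mem_span_singleton.1
    (sub_mem (hzw (intrinsicInterior_subset hu)) (hzw (intrinsicInterior_subset hc)))
  have hmem : t • w ∈ vectorSpan ℝ P := by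
    have := vsub_mem_vectorSpan ℝ (intrinsicInterior_subset hu') (intrinsicInterior_subset hz)
    rw [ht]
    convert this using 1
    simp only [vsub_eq_sub]
    abel
  obtain rfl : t = 0 := by
    by_contra ht0
    exact hw (((vectorSpan ℝ P).smul_mem_iff ht0).1 hmem)
  rw [zero_smul, eq_comm, sub_eq_zero] at ht
  simp [ht]

theorem exists_inP (L : List Bool) {d : ℕ} (hd : L.length + 2 ≤ d) :
    ∃ P : Set (Fin d → ℝ), InP L P := by
  induction L with
  | nil =>
    have : Nonempty (Fin d) := ⟨⟨0, by simp at hd; omega⟩⟩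
    obtain ⟨x, y, hxy⟩ := exists_pair_ne (Fin d → ℝ)
    exact ⟨_, .seg x y hxy⟩
  | cons b L ih =>
    rw [List.length_cons] at hd
    obtain ⟨P, hP⟩ := ih (by omega)
    have hlt := hP.finrank_vectorSpan_le.trans_lt (show L.length + 1 < d by omega)
    cases b
    · obtain ⟨Q, hQ⟩ := exists_isPyramidOver hP.nonempty hlt
      exact ⟨Q, .pyr L P Q hP hQ⟩
    · obtain ⟨Q, hQ⟩ := exists_isBipyramidOver hP.convex hP.nonempty hlt
      exact ⟨Q, .bipyr L P Q hP hQ⟩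

/-- (1) No polytope of positive dimension is simultaneously a bipyramid and a pyramid:
a bipyramid over a polytope `P` with at least two points is not a pyramid over any
polytope.  (2) Consequently the sequence `σ(P)` of a polytope in the class `𝔓` is
uniquely determined by its combinatorial type, and (3) every sequence is realized;
so in dimension `r > 0` there are exactly `2^(r−1)` distinct `𝔓`-combinatorial types
(the sequences of length `r − 1`). -/
theorem stmt17 :
    (∀ (d : ℕ) (P Q : Set (Fin d → ℝ)), IsPolytope P →
      (∃ p q, p ∈ P ∧ q ∈ P ∧ p ≠ q) → IsBipyramidOver Q P →
      ∀ F : Set (Fin d → ℝ), IsPolytope F → ¬ IsPyramidOver Q F) ∧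
    (∀ (d e : ℕ) (L₁ L₂ : List Bool) (P : Set (Fin d → ℝ)) (Q : Set (Fin e → ℝ)),
      InP L₁ P → InP L₂ Q → CombEquiv P Q → L₁ = L₂) ∧
    (∀ (L : List Bool) (d : ℕ), L.length + 2 ≤ d → ∃ P : Set (Fin d → ℝ), InP L P) := by
  exact ⟨fun d P Q hP ⟨p, q, hp, hq, hpq⟩ hQ F hF =>
      not_isPyramidOver_of_isBipyramidOver hP ⟨p, hp, q, hq, hpq⟩ hQ hF,
    fun d e L₁ L₂ P Q hP hQ h => hP.eq_of_combEquiv hQ h,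
    fun L d hd => exists_inP L hd⟩
end
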